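/- arXiv:2207.13903 — 5 statements merged into one kernel-verified Lean document; each statement's English description precedes it below -/
import Mathlib

section
/- Let a, b, c, d be real numbers such that the polynomial p(x,y) = a + b·x + c·y + d·x·y takes values in (0,∞) on ℝ₊². Then the following are equivalent: (i) 1/p is a joint completely monotone function on ℝ₊²; (ii) b·c − a·d ≥ 0; (iii) the double net {1/p(m,n)}_{m,n ∈ ℤ₊} is joint completely monotone; (iv) the double net {1/p(m,n)}_{m,n ∈ ℤ₊} is a minimal joint completely monotone net. -/
noncomputable section

/-- Partial derivative in the first variable. -/
def pd1 (f : ℝ → ℝ → ℝ) : ℝ → ℝ → ℝ := fun x y => deriv (fun u => f u y) x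

/-- Partial derivative in the second variable. -/
def pd2 (f : ℝ → ℝ → ℝ) : ℝ → ℝ → ℝ := fun x y => deriv (fun v => f x v) y

/-- A function of two variables is joint completely monotone on ℝ₊². -/
def JointCompMonoFun (f : ℝ → ℝ → ℝ) : Prop :=
  ∀ β₁ β₂ : ℕ, ∀ x y : ℝ, 0 ≤ x → 0 ≤ y →
    0 ≤ (-1 : ℝ) ^ (β₁ + β₂) * pd1^[β₁] (pd2^[β₂] f) x y

/-- Forward difference operator for sequences. -/
def dSeq (s : ℕ → ℝ) : ℕ → ℝ := fun m => s (m + 1) - s m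

/-- A sequence is completely monotone. -/
def CompMono (s : ℕ → ℝ) : Prop := ∀ k m : ℕ, 0 ≤ (-1 : ℝ) ^ k * dSeq^[k] s m

/-- First forward difference operator for double nets. -/
def d1 (a : ℕ → ℕ → ℝ) : ℕ → ℕ → ℝ := fun m n => a (m + 1) n - a m n

/-- Second forward difference operator for double nets. -/
def d2 (a : ℕ → ℕ → ℝ) : ℕ → ℕ → ℝ := fun m n => a m (n + 1) - a m n

/-- A double net is joint completely monotone. -/
def JointCompMono (a : ℕ → ℕ → ℝ) : Prop :=
  ∀ β₁ β₂ m n : ℕ, 0 ≤ (-1 : ℝ) ^ (β₁ + β₂) * d1^[β₁] (d2^[β₂] a) m n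

/-- A joint completely monotone double net is minimal. -/
def MinJointCompMono (a : ℕ → ℕ → ℝ) : Prop :=
  JointCompMono a ∧
    (∀ ε : ℝ, 0 < ε → ¬ CompMono (fun k => a k 0 - if k = 0 then ε else 0)) ∧
    (∀ ε : ℝ, 0 < ε → ¬ CompMono (fun k => a 0 k - if k = 0 then ε else 0))

open Filter Topology

/-- If `D` maps every multiple of a member of `S` to the negative of the same multiple of a member
of `S`, on the set `V`, then its iterates do so with alternating signs. -/
theorem exists_iterate_eq_neg_one_pow {α : Type*} {D : (α → α → ℝ) → α → α → ℝ}
    {S : Set (α → α → ℝ)} {V : Set (α × α)}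
    (hD : ∀ f, ∀ G ∈ S, ∀ r : ℝ, (∀ q ∈ V, f q.1 q.2 = r * G q.1 q.2) →
      ∃ G' ∈ S, ∀ q ∈ V, D f q.1 q.2 = -r * G' q.1 q.2)
    (n : ℕ) {f G : α → α → ℝ} (hG : G ∈ S) {r : ℝ}
    (hf : ∀ q ∈ V, f q.1 q.2 = r * G q.1 q.2) :
    ∃ G' ∈ S, ∀ q ∈ V, D^[n] f q.1 q.2 = (-1) ^ n * r * G' q.1 q.2 := by
  induction n with
  | zero => exact ⟨G, hG, by simpa using hf⟩
  | succ n ih =>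
    obtain ⟨G', hG', h⟩ := ih
    obtain ⟨G'', hG'', h'⟩ := hD _ G' hG' _ h
    refine ⟨G'', hG'', fun q hq => ?_⟩
    rw [Function.iterate_succ_apply', h' q hq]
    ring

/-- The sign condition for a mixed iterate of two operators preserving `S` up to sign. -/
theorem neg_one_pow_mul_iterate_nonneg {α : Type*} {D₁ D₂ : (α → α → ℝ) → α → α → ℝ}
    {S : Set (α → α → ℝ)} {V : Set (α × α)}
    (hD₁ : ∀ f, ∀ G ∈ S, ∀ r : ℝ, (∀ q ∈ V, f q.1 q.2 = r * G q.1 q.2) →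
      ∃ G' ∈ S, ∀ q ∈ V, D₁ f q.1 q.2 = -r * G' q.1 q.2)
    (hD₂ : ∀ f, ∀ G ∈ S, ∀ r : ℝ, (∀ q ∈ V, f q.1 q.2 = r * G q.1 q.2) →
      ∃ G' ∈ S, ∀ q ∈ V, D₂ f q.1 q.2 = -r * G' q.1 q.2)
    {f : α → α → ℝ} (hf : f ∈ S) (k l : ℕ) {q : α × α} (hq : q ∈ V)
    (hnonneg : ∀ G ∈ S, 0 ≤ G q.1 q.2) :
    0 ≤ (-1 : ℝ) ^ (k + l) * D₁^[k] (D₂^[l] f) q.1 q.2 := by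
  obtain ⟨G, hG, h⟩ := exists_iterate_eq_neg_one_pow hD₂ l (f := f) hf (r := 1) (by simp)
  obtain ⟨G', hG', h'⟩ := exists_iterate_eq_neg_one_pow hD₁ k hG h
  have hsq : ∀ j : ℕ, ((-1 : ℝ) ^ j) * (-1) ^ j = 1 := fun j => by
    rw [← mul_pow]; norm_num
  have : (-1 : ℝ) ^ (k + l) * D₁^[k] (D₂^[l] f) q.1 q.2 = G' q.1 q.2 := by
    rw [h' q hq, pow_add]
    linear_combination G' q.1 q.2 * (hsq l * (-1 : ℝ) ^ k * (-1) ^ k + hsq k)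
  rw [this]
  exact hnonneg _ hG'

/-- The bilinear polynomial `a + b x + c y + d x y`. -/
def bilin (a b c d x y : ℝ) : ℝ := a + b * x + c * y + d * x * y

theorem coeff_nonneg {a b c d : ℝ}
    (hpos : ∀ x y : ℝ, 0 ≤ x → 0 ≤ y → 0 < a + b * x + c * y + d * x * y) :
    0 < a ∧ 0 ≤ b ∧ 0 ≤ c ∧ 0 ≤ d := by
  have ha : 0 < a := by simpa using hpos 0 0 le_rfl le_rfl
  have hb : 0 ≤ b := by
    by_contra! h
    have := hpos (a / -b) 0 (div_nonneg ha.le (by linarith)) le_rfl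
    have e : b * (a / -b) = -a := by rw [div_neg, mul_neg, mul_div_cancel₀ _ h.ne]
    simp [e] at this
  have hc : 0 ≤ c := by
    by_contra! h
    have := hpos 0 (a / -c) le_rfl (div_nonneg ha.le (by linarith))
    have e : c * (a / -c) = -a := by rw [div_neg, mul_neg, mul_div_cancel₀ _ h.ne]
    simp [e] at this
  refine ⟨ha, hb, hc, ?_⟩
  by_contra! h
  obtain ⟨t, ht⟩ : ∃ t, t = (a + b + c) / -d := ⟨_, rfl⟩
  have ht0 : 0 ≤ t := ht ▸ div_nonneg (by linarith) (by linarith)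
  have e : d * t = -(a + b + c) := by rw [ht, div_neg, mul_neg, mul_div_cancel₀ _ h.ne]
  have := hpos (1 + t) (1 + t) (by linarith) (by linarith)
  have e2 : a + b * (1 + t) + c * (1 + t) + d * (1 + t) * (1 + t)
      = a * (1 - (1 + t)) + d * (1 + t) := by
    linear_combination (1 + t) * e
  rw [e2] at this
  nlinarith

/-- Functions whose nonnegative polynomial combinations contain `1 / p` and are stable under
negated partial derivatives. -/
def funGens (a b c d : ℝ) : Set (ℝ → ℝ → ℝ) :=
  {fun x y => 1 / bilin a b c d x y, fun x y => (c + d * x) / bilin a b c d x y,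
    fun x y => (b + d * y) / bilin a b c d x y, fun _ _ => b * c - a * d}

theorem nonneg_of_mem_closure_funGens {a b c d : ℝ} (hb : 0 ≤ b) (hc : 0 ≤ c) (hd : 0 ≤ d)
    (hdet : 0 ≤ b * c - a * d) {x y : ℝ} (hx : 0 ≤ x) (hy : 0 ≤ y)
    (hp : 0 ≤ bilin a b c d x y) :
    ∀ G ∈ Subsemiring.closure (funGens a b c d), 0 ≤ G x y := by
  intro G hG
  induction hG using Subsemiring.closure_induction with
  | mem F hF => rcases hF with rfl | rfl | rfl | rfl <;> positivity
  | zero => simp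
  | one => simp
  | add F G _ _ hF hG => exact add_nonneg hF hG
  | mul F G _ _ hF hG => exact mul_nonneg hF hG

theorem hasDerivAt_bilin_left (a b c d x y : ℝ) :
    HasDerivAt (fun u => bilin a b c d u y) (b + d * y) x := by
  have : HasDerivAt (fun u => a + c * y + (b + d * y) * u) ((b + d * y) * 1) x :=
    ((hasDerivAt_id x).const_mul _).const_add _
  convert this using 1
  · funext u; simp only [bilin]; ring
  · ring

theorem hasDerivAt_bilin_right (a b c d x y : ℝ) :
    HasDerivAt (fun v => bilin a b c d x v) (c + d * x) y := by
  have : HasDerivAt (fun v => a + b * x + (c + d * x) * v) ((c + d * x) * 1) y :=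
    ((hasDerivAt_id y).const_mul _).const_add _
  convert this using 1
  · funext u; simp only [bilin]; ring
  · ring

theorem exists_hasDerivAt_left_of_mem_closure_funGens {a b c d : ℝ} :
    ∀ G ∈ Subsemiring.closure (funGens a b c d), ∃ G' ∈ Subsemiring.closure (funGens a b c d),
      ∀ x y, bilin a b c d x y ≠ 0 → HasDerivAt (fun u => G u y) (-G' x y) x := by
  have m {F} (h : F ∈ funGens a b c d) : F ∈ Subsemiring.closure (funGens a b c d) :=
    Subsemiring.subset_closure h
  have mg := m (F := fun x y => 1 / bilin a b c d x y) (by simp [funGens])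
  have mk := m (F := fun x y => (b + d * y) / bilin a b c d x y) (by simp [funGens])
  have md := m (F := fun _ _ => b * c - a * d) (by simp [funGens])
  intro G hG
  induction hG using Subsemiring.closure_induction with
  | mem F hF =>
    rcases hF with rfl | rfl | rfl | rfl
    · refine ⟨_, mul_mem mk mg, fun x y hp => ?_⟩
      refine ((hasDerivAt_const x 1).div (hasDerivAt_bilin_left a b c d x y) hp).congr_deriv ?_
      simp only [Pi.mul_apply]
      field_simp
      ring
    · refine ⟨_, mul_mem md (mul_mem mg mg), fun x y hp => ?_⟩
      refine ((((hasDerivAt_id x).const_mul d).const_add c).div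
        (hasDerivAt_bilin_left a b c d x y) hp).congr_deriv ?_
      simp only [Pi.mul_apply]
      field_simp
      simp only [bilin, id]
      ring
    · refine ⟨_, mul_mem mk mk, fun x y hp => ?_⟩
      refine ((hasDerivAt_const x (b + d * y)).div
        (hasDerivAt_bilin_left a b c d x y) hp).congr_deriv ?_
      simp only [Pi.mul_apply]
      field_simp
      ring
    · exact ⟨0, zero_mem _, fun x y _ => by simpa using hasDerivAt_const x (b * c - a * d)⟩
  | zero => exact ⟨0, zero_mem _, fun x y _ => by simpa using hasDerivAt_const x (0 : ℝ)⟩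
  | one => exact ⟨0, zero_mem _, fun x y _ => by simpa using hasDerivAt_const x (1 : ℝ)⟩
  | add F G _ _ hF hG =>
    obtain ⟨F', hF', h⟩ := hF
    obtain ⟨G', hG', h'⟩ := hG
    refine ⟨_, add_mem hF' hG', fun x y hp => ((h x y hp).add (h' x y hp)).congr_deriv ?_⟩
    simp only [Pi.add_apply]
    ring
  | mul F G mF mG hF hG =>
    obtain ⟨F', hF', h⟩ := hF
    obtain ⟨G', hG', h'⟩ := hG
    refine ⟨_, add_mem (mul_mem hF' mG) (mul_mem mF hG'),
      fun x y hp => ((h x y hp).mul (h' x y hp)).congr_deriv ?_⟩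
    simp only [Pi.add_apply, Pi.mul_apply]
    ring

theorem exists_hasDerivAt_right_of_mem_closure_funGens {a b c d : ℝ} :
    ∀ G ∈ Subsemiring.closure (funGens a b c d), ∃ G' ∈ Subsemiring.closure (funGens a b c d),
      ∀ x y, bilin a b c d x y ≠ 0 → HasDerivAt (fun v => G x v) (-G' x y) y := by
  have m {F} (h : F ∈ funGens a b c d) : F ∈ Subsemiring.closure (funGens a b c d) :=
    Subsemiring.subset_closure h
  have mg := m (F := fun x y => 1 / bilin a b c d x y) (by simp [funGens])
  have mh := m (F := fun x y => (c + d * x) / bilin a b c d x y) (by simp [funGens])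
  have md := m (F := fun _ _ => b * c - a * d) (by simp [funGens])
  intro G hG
  induction hG using Subsemiring.closure_induction with
  | mem F hF =>
    rcases hF with rfl | rfl | rfl | rfl
    · refine ⟨_, mul_mem mh mg, fun x y hp => ?_⟩
      refine ((hasDerivAt_const y 1).div (hasDerivAt_bilin_right a b c d x y) hp).congr_deriv ?_
      simp only [Pi.mul_apply]
      field_simp
      ring
    · refine ⟨_, mul_mem mh mh, fun x y hp => ?_⟩
      refine ((hasDerivAt_const y (c + d * x)).div
        (hasDerivAt_bilin_right a b c d x y) hp).congr_deriv ?_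
      simp only [Pi.mul_apply]
      field_simp
      ring
    · refine ⟨_, mul_mem md (mul_mem mg mg), fun x y hp => ?_⟩
      refine ((((hasDerivAt_id y).const_mul d).const_add b).div
        (hasDerivAt_bilin_right a b c d x y) hp).congr_deriv ?_
      simp only [Pi.mul_apply]
      field_simp
      simp only [bilin, id]
      ring
    · exact ⟨0, zero_mem _, fun x y _ => by simpa using hasDerivAt_const y (b * c - a * d)⟩
  | zero => exact ⟨0, zero_mem _, fun x y _ => by simpa using hasDerivAt_const y (0 : ℝ)⟩
  | one => exact ⟨0, zero_mem _, fun x y _ => by simpa using hasDerivAt_const y (1 : ℝ)⟩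
  | add F G _ _ hF hG =>
    obtain ⟨F', hF', h⟩ := hF
    obtain ⟨G', hG', h'⟩ := hG
    refine ⟨_, add_mem hF' hG', fun x y hp => ((h x y hp).add (h' x y hp)).congr_deriv ?_⟩
    simp only [Pi.add_apply]
    ring
  | mul F G mF mG hF hG =>
    obtain ⟨F', hF', h⟩ := hF
    obtain ⟨G', hG', h'⟩ := hG
    refine ⟨_, add_mem (mul_mem hF' mG) (mul_mem mF hG'),
      fun x y hp => ((h x y hp).mul (h' x y hp)).congr_deriv ?_⟩
    simp only [Pi.add_apply, Pi.mul_apply]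
    ring

theorem jointCompMonoFun_one_div_bilin {a b c d : ℝ}
    (hpos : ∀ x y : ℝ, 0 ≤ x → 0 ≤ y → 0 < bilin a b c d x y) (hdet : 0 ≤ b * c - a * d) :
    JointCompMonoFun (fun x y => 1 / bilin a b c d x y) := by
  obtain ⟨-, hb, hc, hd⟩ := coeff_nonneg hpos
  intro k l x y hx hy
  refine neg_one_pow_mul_iterate_nonneg (S := Subsemiring.closure (funGens a b c d))
    (V := {q | bilin a b c d q.1 q.2 ≠ 0}) ?_ ?_ (Subsemiring.subset_closure (by simp [funGens]))
    k l (q := (x, y)) (hpos x y hx hy).ne'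
    (nonneg_of_mem_closure_funGens hb hc hd hdet hx hy (hpos x y hx hy).le)
  · intro f G hG r hf
    obtain ⟨G', hG', h⟩ := exists_hasDerivAt_left_of_mem_closure_funGens G hG
    refine ⟨G', hG', fun q hq => ?_⟩
    have hev : (fun u => f u q.2) =ᶠ[𝓝 q.1] fun u => r * G u q.2 := by
      filter_upwards [(hasDerivAt_bilin_left a b c d q.1 q.2).continuousAt.eventually_ne hq]
        with u hu using hf (u, q.2) hu
    rw [pd1, hev.deriv_eq, ((h q.1 q.2 hq).const_mul r).deriv]
    ring
  · intro f G hG r hf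
    obtain ⟨G', hG', h⟩ := exists_hasDerivAt_right_of_mem_closure_funGens G hG
    refine ⟨G', hG', fun q hq => ?_⟩
    have hev : (fun v => f q.1 v) =ᶠ[𝓝 q.2] fun v => r * G q.1 v := by
      filter_upwards [(hasDerivAt_bilin_right a b c d q.1 q.2).continuousAt.eventually_ne hq]
        with v hv using hf (q.1, v) hv
    rw [pd2, hev.deriv_eq, ((h q.1 q.2 hq).const_mul r).deriv]
    ring

/-- Nets whose nonnegative polynomial combinations contain `1 / p` and are stable under shifts and
negated differences. -/
def netGens (a b c d : ℝ) : Set (ℕ → ℕ → ℝ) :=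
  {F | ∃ i j : ℕ, F = (fun m n : ℕ => 1 / bilin a b c d (m + i) (n + j)) ∨
    F = (fun m n : ℕ => (c + d * (m + i)) / bilin a b c d (m + i) (n + j)) ∨
    F = (fun m n : ℕ => (b + d * (n + j)) / bilin a b c d (m + i) (n + j)) ∨
    F = fun _ _ => b * c - a * d}

theorem nonneg_of_mem_closure_netGens {a b c d : ℝ} (hb : 0 ≤ b) (hc : 0 ≤ c) (hd : 0 ≤ d)
    (hdet : 0 ≤ b * c - a * d)
    (hp : ∀ x y : ℝ, 0 ≤ x → 0 ≤ y → 0 < bilin a b c d x y) (m n : ℕ) :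
    ∀ G ∈ Subsemiring.closure (netGens a b c d), 0 ≤ G m n := by
  intro G hG
  induction hG using Subsemiring.closure_induction with
  | mem F hF =>
    obtain ⟨i, j, hF⟩ := hF
    have := hp (m + i) (n + j) (by positivity) (by positivity)
    rcases hF with rfl | rfl | rfl | rfl <;> positivity
  | zero => simp
  | one => simp
  | add F G _ _ hF hG => exact add_nonneg hF hG
  | mul F G _ _ hF hG => exact mul_nonneg hF hG

theorem exists_d1_of_mem_closure_netGens {a b c d : ℝ}
    (hp : ∀ x y : ℝ, 0 ≤ x → 0 ≤ y → 0 < bilin a b c d x y) :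
    ∀ G ∈ Subsemiring.closure (netGens a b c d),
      (fun m n => G (m + 1) n) ∈ Subsemiring.closure (netGens a b c d) ∧
      ∃ G' ∈ Subsemiring.closure (netGens a b c d), ∀ m n, d1 G m n = -G' m n := by
  have m {F} (h : F ∈ netGens a b c d) : F ∈ Subsemiring.closure (netGens a b c d) :=
    Subsemiring.subset_closure h
  have mg (i j : ℕ) := m (F := fun m n : ℕ => 1 / bilin a b c d (m + i) (n + j)) ⟨i, j, by simp⟩
  have mh (i j : ℕ) := m (F := fun m n : ℕ => (c + d * (m + i)) / bilin a b c d (m + i) (n + j))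
    ⟨i, j, by simp⟩
  have mk (i j : ℕ) := m (F := fun m n : ℕ => (b + d * (n + j)) / bilin a b c d (m + i) (n + j))
    ⟨i, j, by simp⟩
  have md := m (F := fun _ _ => b * c - a * d) ⟨0, 0, by simp⟩
  intro G hG
  induction hG using Subsemiring.closure_induction with
  | mem F hF =>
    obtain ⟨i, j, hF⟩ := hF
    have hne (m n : ℕ) := (hp (m + i) (n + j) (by positivity) (by positivity)).ne'
    have hne' (m n : ℕ) := (hp (m + 1 + i) (n + j) (by positivity) (by positivity)).ne'
    have hs (m : ℕ) : (m : ℝ) + ((i : ℝ) + 1) = m + 1 + i := by ring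
    rcases hF with rfl | rfl | rfl | rfl
    · refine ⟨by simpa only [hs, Nat.cast_add_one] using mg (i + 1) j, _,
        mul_mem (mk i j) (mg (i + 1) j), fun m n => ?_⟩
      have h1 := hne m n
      have h2 := hne' m n
      simp only [d1, Pi.mul_apply, hs, Nat.cast_add_one]
      field_simp
      simp only [bilin]
      ring
    · refine ⟨by simpa only [hs, Nat.cast_add_one] using mh (i + 1) j, _,
        mul_mem md (mul_mem (mg i j) (mg (i + 1) j)), fun m n => ?_⟩
      have h1 := hne m n
      have h2 := hne' m n
      simp only [d1, Pi.mul_apply, hs, Nat.cast_add_one]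
      field_simp
      simp only [bilin]
      ring
    · refine ⟨by simpa only [hs, Nat.cast_add_one] using mk (i + 1) j, _,
        mul_mem (mk i j) (mk (i + 1) j), fun m n => ?_⟩
      have h1 := hne m n
      have h2 := hne' m n
      simp only [d1, Pi.mul_apply, hs, Nat.cast_add_one]
      field_simp
      simp only [bilin]
      ring
    · exact ⟨md, 0, zero_mem _, fun m n => by simp [d1]⟩
  | zero => exact ⟨zero_mem _, 0, zero_mem _, fun m n => by simp [d1]⟩
  | one => exact ⟨one_mem _, 0, zero_mem _, fun m n => by simp [d1]⟩
  | add F G _ _ hF hG =>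
    obtain ⟨sF, F', hF', h⟩ := hF
    obtain ⟨sG, G', hG', h'⟩ := hG
    refine ⟨add_mem sF sG, _, add_mem hF' hG', fun m n => ?_⟩
    have h1 := h m n
    have h2 := h' m n
    simp only [d1, Pi.add_apply] at *
    linear_combination h1 + h2
  | mul F G mF mG hF hG =>
    obtain ⟨sF, F', hF', h⟩ := hF
    obtain ⟨sG, G', hG', h'⟩ := hG
    refine ⟨mul_mem sF sG, _, add_mem (mul_mem hF' mG) (mul_mem sF hG'), fun m n => ?_⟩
    have h1 := h m n
    have h2 := h' m n
    simp only [d1, Pi.add_apply, Pi.mul_apply] at *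
    linear_combination G m n * h1 + F (m + 1) n * h2

theorem exists_d2_of_mem_closure_netGens {a b c d : ℝ}
    (hp : ∀ x y : ℝ, 0 ≤ x → 0 ≤ y → 0 < bilin a b c d x y) :
    ∀ G ∈ Subsemiring.closure (netGens a b c d),
      (fun m n => G m (n + 1)) ∈ Subsemiring.closure (netGens a b c d) ∧
      ∃ G' ∈ Subsemiring.closure (netGens a b c d), ∀ m n, d2 G m n = -G' m n := by
  have m {F} (h : F ∈ netGens a b c d) : F ∈ Subsemiring.closure (netGens a b c d) :=
    Subsemiring.subset_closure h
  have mg (i j : ℕ) := m (F := fun m n : ℕ => 1 / bilin a b c d (m + i) (n + j)) ⟨i, j, by simp⟩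
  have mh (i j : ℕ) := m (F := fun m n : ℕ => (c + d * (m + i)) / bilin a b c d (m + i) (n + j))
    ⟨i, j, by simp⟩
  have mk (i j : ℕ) := m (F := fun m n : ℕ => (b + d * (n + j)) / bilin a b c d (m + i) (n + j))
    ⟨i, j, by simp⟩
  have md := m (F := fun _ _ => b * c - a * d) ⟨0, 0, by simp⟩
  intro G hG
  induction hG using Subsemiring.closure_induction with
  | mem F hF =>
    obtain ⟨i, j, hF⟩ := hF
    have hne (m n : ℕ) := (hp (m + i) (n + j) (by positivity) (by positivity)).ne'
    have hne' (m n : ℕ) := (hp (m + i) (n + 1 + j) (by positivity) (by positivity)).ne'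
    have hs (n : ℕ) : (n : ℝ) + ((j : ℝ) + 1) = n + 1 + j := by ring
    rcases hF with rfl | rfl | rfl | rfl
    · refine ⟨by simpa only [hs, Nat.cast_add_one] using mg i (j + 1), _,
        mul_mem (mh i j) (mg i (j + 1)), fun m n => ?_⟩
      have h1 := hne m n
      have h2 := hne' m n
      simp only [d2, Pi.mul_apply, hs, Nat.cast_add_one]
      field_simp
      simp only [bilin]
      ring
    · refine ⟨by simpa only [hs, Nat.cast_add_one] using mh i (j + 1), _,
        mul_mem (mh i j) (mh i (j + 1)), fun m n => ?_⟩
      have h1 := hne m n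
      have h2 := hne' m n
      simp only [d2, Pi.mul_apply, hs, Nat.cast_add_one]
      field_simp
      simp only [bilin]
      ring
    · refine ⟨by simpa only [hs, Nat.cast_add_one] using mk i (j + 1), _,
        mul_mem md (mul_mem (mg i j) (mg i (j + 1))), fun m n => ?_⟩
      have h1 := hne m n
      have h2 := hne' m n
      simp only [d2, Pi.mul_apply, hs, Nat.cast_add_one]
      field_simp
      simp only [bilin]
      ring
    · exact ⟨md, 0, zero_mem _, fun m n => by simp [d2]⟩
  | zero => exact ⟨zero_mem _, 0, zero_mem _, fun m n => by simp [d2]⟩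
  | one => exact ⟨one_mem _, 0, zero_mem _, fun m n => by simp [d2]⟩
  | add F G _ _ hF hG =>
    obtain ⟨sF, F', hF', h⟩ := hF
    obtain ⟨sG, G', hG', h'⟩ := hG
    refine ⟨add_mem sF sG, _, add_mem hF' hG', fun m n => ?_⟩
    have h1 := h m n
    have h2 := h' m n
    simp only [d2, Pi.add_apply] at *
    linear_combination h1 + h2
  | mul F G mF mG hF hG =>
    obtain ⟨sF, F', hF', h⟩ := hF
    obtain ⟨sG, G', hG', h'⟩ := hG
    refine ⟨mul_mem sF sG, _, add_mem (mul_mem hF' mG) (mul_mem sF hG'), fun m n => ?_⟩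
    have h1 := h m n
    have h2 := h' m n
    simp only [d2, Pi.add_apply, Pi.mul_apply] at *
    linear_combination G m n * h1 + F m (n + 1) * h2

theorem jointCompMono_one_div_bilin {a b c d : ℝ}
    (hpos : ∀ x y : ℝ, 0 ≤ x → 0 ≤ y → 0 < bilin a b c d x y) (hdet : 0 ≤ b * c - a * d) :
    JointCompMono (fun m n => 1 / bilin a b c d m n) := by
  obtain ⟨-, hb, hc, hd⟩ := coeff_nonneg hpos
  intro k l m n
  refine neg_one_pow_mul_iterate_nonneg (S := Subsemiring.closure (netGens a b c d))
    (V := Set.univ) ?_ ?_ (Subsemiring.subset_closure (s := netGens a b c d) ⟨0, 0, by simp⟩)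
    k l (q := (m, n)) (Set.mem_univ _)
    (nonneg_of_mem_closure_netGens hb hc hd hdet hpos m n)
  · intro f G hG r hf
    obtain ⟨-, G', hG', h⟩ := exists_d1_of_mem_closure_netGens hpos G hG
    refine ⟨G', hG', fun q _ => ?_⟩
    have h1 := h q.1 q.2
    have h2 := hf q trivial
    have h3 := hf (q.1 + 1, q.2) trivial
    simp only [d1] at *
    linear_combination h3 - h2 + r * h1
  · intro f G hG r hf
    obtain ⟨-, G', hG', h⟩ := exists_d2_of_mem_closure_netGens hpos G hG
    refine ⟨G', hG', fun q _ => ?_⟩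
    have h1 := h q.1 q.2
    have h2 := hf q trivial
    have h3 := hf (q.1, q.2 + 1) trivial
    simp only [d2] at *
    linear_combination h3 - h2 + r * h1

theorem pd2_iterate (f : ℝ → ℝ → ℝ) (n : ℕ) (x y : ℝ) : pd2^[n] f x y = deriv^[n] (f x) y := by
  induction n generalizing f with
  | zero => rfl
  | succ n ih => rw [Function.iterate_succ_apply, Function.iterate_succ_apply, ih]; rfl

theorem d2_iterate (f : ℕ → ℕ → ℝ) (k m n : ℕ) : d2^[k] f m n = dSeq^[k] (f m) n := by
  induction k generalizing f with
  | zero => rfl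
  | succ k ih => rw [Function.iterate_succ_apply, Function.iterate_succ_apply, ih]; rfl

theorem det_nonneg_of_jointCompMonoFun {a b c d : ℝ}
    (hpos : ∀ x y : ℝ, 0 ≤ x → 0 ≤ y → 0 < bilin a b c d x y)
    (h : JointCompMonoFun (fun x y => 1 / bilin a b c d x y)) : 0 ≤ b * c - a * d := by
  obtain ⟨ha, hb, hc, hd⟩ := coeff_nonneg hpos
  by_contra! hdet
  have hd' : 0 < d := by nlinarith [mul_nonneg hb hc]
  obtain ⟨N, hN⟩ := exists_nat_gt (b * (c + d) / (a * d - b * c))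
  rw [div_lt_iff₀ (by linarith)] at hN
  have key := h 1 (N + 1) 1 0 zero_le_one le_rfl
  have hp2 : ∀ x : ℝ, pd2^[N + 1] (fun x y => 1 / bilin a b c d x y) x 0 =
      (-1) ^ (N + 1) * (N + 1).factorial * (c + d * x) ^ (N + 1)
        / (a + b * x) ^ (N + 2) := by
    intro x
    have e : (fun y => 1 / bilin a b c d x y) = fun y => ((c + d * x) * y + (a + b * x))⁻¹ := by
      funext y
      rw [one_div, bilin]
      congr 1
      ring
    rw [pd2_iterate, e, iter_deriv_inv_linear]
    have e2 : (-1 - ((N + 1 : ℕ) : ℤ)) = -((N + 2 : ℕ) : ℤ) := by push_cast; ring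
    beta_reduce
    rw [e2, zpow_neg, zpow_natCast, mul_zero, zero_add, div_eq_mul_inv]
  have hab : 0 < a + b * 1 := by linarith
  have h1 : HasDerivAt (fun x : ℝ => (c + d * x) ^ (N + 1))
      (((N + 1 : ℕ) : ℝ) * (c + d * 1) ^ N * (d * 1)) 1 :=
    (((hasDerivAt_id (1 : ℝ)).const_mul d).const_add c).pow (N + 1)
  have h2 : HasDerivAt (fun x : ℝ => (a + b * x) ^ (N + 2))
      (((N + 2 : ℕ) : ℝ) * (a + b * 1) ^ (N + 1) * (b * 1)) 1 :=
    (((hasDerivAt_id (1 : ℝ)).const_mul b).const_add a).pow (N + 2)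
  have h3 := (h1.const_mul ((-1 : ℝ) ^ (N + 1) * (N + 1).factorial)).div h2 (by positivity)
  simp only [Function.iterate_one, pd1, hp2] at key
  rw [show (fun u : ℝ => (-1) ^ (N + 1) * ((N + 1).factorial : ℝ) * (c + d * u) ^ (N + 1)
        / (a + b * u) ^ (N + 2)) = (fun u : ℝ => (-1) ^ (N + 1) * ((N + 1).factorial : ℝ) *
        (c + d * u) ^ (N + 1)) / (fun u : ℝ => (a + b * u) ^ (N + 2)) from rfl, h3.deriv] at key
  have hsq : ((-1 : ℝ) ^ N) * (-1) ^ N = 1 := by rw [← mul_pow]; norm_num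
  have e : (-1 : ℝ) ^ (1 + (N + 1)) *
      (((-1) ^ (N + 1) * ((N + 1).factorial : ℝ) * (((N + 1 : ℕ) : ℝ) * (c + d * 1) ^ N * (d * 1)) *
        (a + b * 1) ^ (N + 2) - (-1) ^ (N + 1) * ((N + 1).factorial : ℝ) * (c + d * 1) ^ (N + 1) *
        (((N + 2 : ℕ) : ℝ) * (a + b * 1) ^ (N + 1) * (b * 1))) / ((a + b * 1) ^ (N + 2)) ^ 2) =
      ((N + 1).factorial * (c + d) ^ N * (a + b) ^ (N + 1) / ((a + b) ^ (N + 2)) ^ 2) *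
        (b * (c + d) - (N + 1) * (a * d - b * c)) := by
    push_cast
    simp only [mul_one]
    rw [mul_div_assoc', div_mul_eq_mul_div]
    congr 1
    linear_combination (((N + 1).factorial : ℝ) * (c + d) ^ N * (a + b) ^ (N + 1) *
      (b * (c + d) - (N + 1) * (a * d - b * c))) * hsq
  rw [e] at key
  have hfac : 0 < (N + 1).factorial * (c + d) ^ N * (a + b) ^ (N + 1) /
      ((a + b) ^ (N + 2)) ^ 2 := by
    have : 0 < a + b := by linarith
    positivity
  have := nonneg_of_mul_nonneg_right key hfac
  nlinarith

/-- Iterated differences of the reciprocal of an affine sequence. -/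
theorem dSeq_iterate_one_div {A B : ℝ} (hA : 0 < A) (hB : 0 ≤ B) (k m : ℕ) :
    (-1 : ℝ) ^ k * dSeq^[k] (fun j => 1 / (A + B * j)) m =
      k.factorial * B ^ k / ∏ j ∈ Finset.range (k + 1), (A + B * (m + j)) := by
  induction k generalizing m with
  | zero => simp
  | succ k ih =>
    have h1 := ih m
    have h2 := ih (m + 1)
    have hne (t : ℝ) (ht : 0 ≤ t) : A + B * t ≠ 0 := by positivity
    have hP : ∏ j ∈ Finset.range k, (A + B * (m + ((j + 1 : ℕ) : ℝ))) ≠ 0 :=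
      Finset.prod_ne_zero_iff.2 fun j _ => hne _ (by positivity)
    have e1 : ∏ j ∈ Finset.range (k + 1), (A + B * (m + (j : ℝ))) =
        (∏ j ∈ Finset.range k, (A + B * (m + ((j + 1 : ℕ) : ℝ)))) * (A + B * m) := by
      rw [Finset.prod_range_succ']; simp
    have e2 : ∏ j ∈ Finset.range (k + 1), (A + B * (((m + 1 : ℕ) : ℝ) + (j : ℝ))) =
        (∏ j ∈ Finset.range k, (A + B * (m + ((j + 1 : ℕ) : ℝ)))) * (A + B * (m + (k + 1))) := by
      rw [Finset.prod_range_succ]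
      push_cast
      congr 1
      · exact Finset.prod_congr rfl fun j _ => by ring
      · ring
    have e3 : ∏ j ∈ Finset.range (k + 1 + 1), (A + B * (m + (j : ℝ))) =
        (∏ j ∈ Finset.range k, (A + B * (m + ((j + 1 : ℕ) : ℝ)))) * (A + B * m) *
          (A + B * (m + (k + 1))) := by
      rw [Finset.prod_range_succ, e1]; push_cast; ring
    rw [Function.iterate_succ_apply', dSeq]
    have : (-1 : ℝ) ^ (k + 1) * (dSeq^[k] (fun j => 1 / (A + B * j)) (m + 1) -
        dSeq^[k] (fun j => 1 / (A + B * j)) m) =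
        (-1 : ℝ) ^ k * dSeq^[k] (fun j => 1 / (A + B * j)) m -
        (-1 : ℝ) ^ k * dSeq^[k] (fun j => 1 / (A + B * j)) (m + 1) := by ring
    rw [this, h1, h2, e1, e2, e3]
    have hx := hne m (by positivity)
    have hy := hne (m + (k + 1)) (by positivity)
    rw [Nat.factorial_succ]
    push_cast at hP ⊢
    field_simp
    ring

theorem factorial_mul_pow_div_prod_eq_GammaSeq {A B : ℝ} (hB : 0 < B) {k : ℕ} (hk : 0 < k) :
    k.factorial * B ^ k / ∏ j ∈ Finset.range (k + 1), (A + B * j) =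
      B⁻¹ * Real.GammaSeq (A / B) k * (k : ℝ) ^ (-(A / B)) := by
  have e : ∏ j ∈ Finset.range (k + 1), (A + B * j) =
      B ^ (k + 1) * ∏ j ∈ Finset.range (k + 1), (A / B + j) := by
    rw [← Finset.card_range (k + 1), ← Finset.prod_const, Finset.card_range,
      ← Finset.prod_mul_distrib]
    exact Finset.prod_congr rfl fun j _ => by field_simp
  have hk' : (0 : ℝ) < k := by exact_mod_cast hk
  have hr : (k : ℝ) ^ (A / B) * (k : ℝ) ^ (-(A / B)) = 1 := by
    rw [← Real.rpow_add hk']; simp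
  rw [e, Real.GammaSeq, pow_succ]
  calc _ = k.factorial / (B * ∏ j ∈ Finset.range (k + 1), (A / B + j)) := by
        rw [mul_comm (k.factorial : ℝ), mul_assoc (B ^ k), mul_div_mul_left _ _ (by positivity)]
    _ = (k : ℝ) ^ (A / B) * (k : ℝ) ^ (-(A / B)) *
        (k.factorial / (B * ∏ j ∈ Finset.range (k + 1), (A / B + j))) := by rw [hr, one_mul]
    _ = _ := by rw [div_eq_mul_inv, div_eq_mul_inv, mul_inv]; ring

theorem tendsto_dSeq_iterate_one_div {A B : ℝ} (hA : 0 < A) (hB : 0 ≤ B) :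
    Tendsto (fun k : ℕ => (-1 : ℝ) ^ k * dSeq^[k] (fun j => 1 / (A + B * j)) 0) atTop (𝓝 0) := by
  simp only [dSeq_iterate_one_div hA hB, Nat.cast_zero, zero_add]
  rcases hB.eq_or_lt with rfl | hB
  · refine tendsto_const_nhds.congr' ?_
    filter_upwards [eventually_gt_atTop 0] with k hk
    simp [hk.ne']
  · have h := ((Real.GammaSeq_tendsto_Gamma (A / B)).const_mul B⁻¹).mul
      ((tendsto_rpow_neg_atTop (div_pos hA hB)).comp tendsto_natCast_atTop_atTop)
    rw [mul_zero] at h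
    refine h.congr' ?_
    filter_upwards [eventually_gt_atTop 0] with k hk
    rw [factorial_mul_pow_div_prod_eq_GammaSeq hB hk]
    rfl

theorem dSeq_iterate_sub (s t : ℕ → ℝ) (k : ℕ) :
    dSeq^[k] (fun j => s j - t j) = fun j => dSeq^[k] s j - dSeq^[k] t j := by
  induction k with
  | zero => rfl
  | succ k ih =>
    simp only [Function.iterate_succ_apply', ih]
    funext j
    simp only [dSeq]
    ring

theorem dSeq_iterate_single (ε : ℝ) (k m : ℕ) :
    dSeq^[k] (fun j => if j = 0 then ε else 0) m = if m = 0 then (-1) ^ k * ε else 0 := by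
  induction k generalizing m with
  | zero => simp
  | succ k ih =>
    rw [Function.iterate_succ_apply', dSeq, ih, ih]
    by_cases hm : m = 0 <;> simp [hm, pow_succ]

theorem not_compMono_one_div_sub_single {A B ε : ℝ} (hA : 0 < A) (hB : 0 ≤ B) (hε : 0 < ε) :
    ¬ CompMono (fun k => 1 / (A + B * k) - if k = 0 then ε else 0) := by
  intro h
  obtain ⟨k, hk⟩ := ((tendsto_dSeq_iterate_one_div hA hB).eventually (gt_mem_nhds hε)).exists
  have := h k 0
  have hsq : ((-1 : ℝ) ^ k) * (-1) ^ k = 1 := by rw [← mul_pow]; norm_num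
  rw [dSeq_iterate_sub (fun j : ℕ => 1 / (A + B * j)), mul_sub, dSeq_iterate_single, if_pos rfl,
    ← mul_assoc, hsq] at this
  linarith

theorem det_nonneg_of_jointCompMono {a b c d : ℝ}
    (hpos : ∀ x y : ℝ, 0 ≤ x → 0 ≤ y → 0 < bilin a b c d x y)
    (h : JointCompMono (fun m n => 1 / bilin a b c d m n)) : 0 ≤ b * c - a * d := by
  obtain ⟨ha, hb, hc, hd⟩ := coeff_nonneg hpos
  by_contra! hdet
  have hd' : 0 < d := by nlinarith [mul_nonneg hb hc]
  have hB1 : 0 < c + d := by linarith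
  have hB2 : 0 < c + d * 2 := by linarith
  have hA1 : 0 < a + b := by linarith
  have hA2 : 0 < a + b * 2 := by linarith
  have hlt : (a + b * 2) / (c + d * 2) < (a + b) / (c + d) := by
    rw [div_lt_div_iff₀ hB2 hB1]
    linarith
  have e1 : (fun n : ℕ => 1 / bilin a b c d (1 : ℕ) n) = fun n : ℕ => 1 / (a + b + (c + d) * n) := by
    funext n; congr 1; simp only [bilin]; push_cast; ring
  have e2 : (fun n : ℕ => 1 / bilin a b c d ((1 + 1 : ℕ) : ℝ) n) =
      fun n : ℕ => 1 / (a + b * 2 + (c + d * 2) * n) := by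
    funext n; congr 1; simp only [bilin]; push_cast; ring
  have key : ∀ k : ℕ, 0 < k →
      (c + d * 2)⁻¹ * Real.GammaSeq ((a + b * 2) / (c + d * 2)) k *
        (k : ℝ) ^ ((a + b) / (c + d) - (a + b * 2) / (c + d * 2)) ≤
      (c + d)⁻¹ * Real.GammaSeq ((a + b) / (c + d)) k := by
    intro k hk
    have h0 := h 1 k 1 0
    have h1 := dSeq_iterate_one_div hA1 hB1.le k 0
    have h2 := dSeq_iterate_one_div hA2 hB2.le k 0
    simp only [Nat.cast_zero, zero_add] at h1 h2
    rw [factorial_mul_pow_div_prod_eq_GammaSeq hB1 hk] at h1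
    rw [factorial_mul_pow_div_prod_eq_GammaSeq hB2 hk] at h2
    simp only [Function.iterate_one, d1, d2_iterate] at h0
    rw [e1, e2, pow_add] at h0
    have hk' : (0 : ℝ) < k := by exact_mod_cast hk
    have hle := sub_nonneg.1 (show 0 ≤ _ - _ by linarith only [h0, h1, h2] :
      (0 : ℝ) ≤ (c + d)⁻¹ * Real.GammaSeq ((a + b) / (c + d)) k * (k : ℝ) ^ (-((a + b) / (c + d))) -
        (c + d * 2)⁻¹ * Real.GammaSeq ((a + b * 2) / (c + d * 2)) k *
        (k : ℝ) ^ (-((a + b * 2) / (c + d * 2))))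
    have := mul_le_mul_of_nonneg_right hle (Real.rpow_nonneg hk'.le ((a + b) / (c + d)))
    rwa [mul_assoc, mul_assoc _ _ ((k : ℝ) ^ ((a + b) / (c + d))), ← Real.rpow_add hk',
      ← Real.rpow_add hk', neg_add_cancel, Real.rpow_zero, mul_one, neg_add_eq_sub] at this
  have hL : Tendsto (fun k : ℕ => (c + d * 2)⁻¹ * Real.GammaSeq ((a + b * 2) / (c + d * 2)) k *
      (k : ℝ) ^ ((a + b) / (c + d) - (a + b * 2) / (c + d * 2))) atTop atTop :=
    ((Real.GammaSeq_tendsto_Gamma _).const_mul _).pos_mul_atTop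
      (mul_pos (inv_pos.2 hB2) (Real.Gamma_pos_of_pos (div_pos hA2 hB2)))
      ((tendsto_rpow_atTop (sub_pos.2 hlt)).comp tendsto_natCast_atTop_atTop)
  refine not_tendsto_nhds_of_tendsto_atTop (tendsto_atTop_mono' _ ?_ hL) _
    ((Real.GammaSeq_tendsto_Gamma ((a + b) / (c + d))).const_mul (c + d)⁻¹)
  filter_upwards [eventually_gt_atTop 0] with k hk using key k hk

theorem minJointCompMono_one_div_bilin {a b c d : ℝ}
    (hpos : ∀ x y : ℝ, 0 ≤ x → 0 ≤ y → 0 < bilin a b c d x y) (hdet : 0 ≤ b * c - a * d) :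
    MinJointCompMono (fun m n => 1 / bilin a b c d m n) := by
  obtain ⟨ha, hb, hc, -⟩ := coeff_nonneg hpos
  refine ⟨jointCompMono_one_div_bilin hpos hdet, fun ε hε => ?_, fun ε hε => ?_⟩
  · simpa [bilin] using not_compMono_one_div_sub_single ha hb hε
  · simpa [bilin] using not_compMono_one_div_sub_single ha hc hε

theorem statement12 (a b c d : ℝ)
    (hpos : ∀ x y : ℝ, 0 ≤ x → 0 ≤ y → 0 < a + b * x + c * y + d * x * y) :
    (JointCompMonoFun (fun x y => 1 / (a + b * x + c * y + d * x * y)) ↔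
      0 ≤ b * c - a * d) ∧
    (JointCompMono (fun m n =>
        1 / (a + b * m + c * n + d * m * n)) ↔ 0 ≤ b * c - a * d) ∧
    (MinJointCompMono (fun m n =>
        1 / (a + b * m + c * n + d * m * n)) ↔ 0 ≤ b * c - a * d) :=
  ⟨⟨det_nonneg_of_jointCompMonoFun hpos, jointCompMonoFun_one_div_bilin hpos⟩,
    ⟨det_nonneg_of_jointCompMono hpos, jointCompMono_one_div_bilin hpos⟩,
    ⟨fun h => det_nonneg_of_jointCompMono hpos h.1, minJointCompMono_one_div_bilin hpos⟩⟩
end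
end

section
/- Let a and b be real polynomials in one variable with deg b = 2 and deg a ≤ 2, let p(x,y) = b(x) + a(x)·y, and assume p takes values in (0,∞) on ℝ₊² and that p has bi-degree (2,1) (i.e. a is not the zero polynomial). If 1/p is a joint completely monotone function on ℝ₊², then: (i) a(x) ≥ 0 for all x ≥ 0, 1 ≤ deg a ≤ 2, and every complex root of a is a nonpositive real number; (ii) b(x) > 0 for all x ≥ 0 and every complex root of b is a negative real number. In particular, either p(x,y) = b_0·(x+b_1)(x+b_2) + a_0·(x+a_1)(x+a_2)·y or p(x,y) = b_0·(x+b_1)(x+b_2) + a_0·(x+a_1)·y, where a_0, b_0, b_1, b_2 > 0 and a_1, a_2 ≥ 0. -/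
noncomputable section

open Polynomial

lemma pd1_iterate_eq_iteratedDeriv (f : ℝ → ℝ → ℝ) (n : ℕ) (x y : ℝ) :
    pd1^[n] f x y = iteratedDeriv n (fun u => f u y) x := by
  induction n generalizing x with
  | zero => simp
  | succ n ih =>
    rw [Function.iterate_succ_apply', iteratedDeriv_succ, pd1]
    congr 1
    exact funext ih

lemma leading_coeff_nonneg_of_quadratic_nonneg {c₀ c₁ c₂ : ℝ}
    (h : ∀ x : ℝ, 0 ≤ x → 0 ≤ c₀ + c₁ * x + c₂ * x ^ 2) : 0 ≤ c₂ := by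
  by_contra! hc
  have hM : 0 < |c₀| + |c₁| + 1 := by positivity
  have hd : 0 < (|c₀| + |c₁| + 1) / (-c₂) := div_pos hM (by linarith)
  obtain ⟨x, hx⟩ : ∃ x, x = 1 + (|c₀| + |c₁| + 1) / (-c₂) := ⟨_, rfl⟩
  have hx1 : 1 ≤ x := by linarith
  have hcx : c₂ * x = c₂ - (|c₀| + |c₁| + 1) := by
    rw [hx]; field_simp [hc.ne]; ring
  have h1 : c₂ * x ^ 2 = (c₂ - (|c₀| + |c₁| + 1)) * x := by rw [← hcx]; ring
  have h2 := h x (by linarith)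
  have h3 : c₁ * x ≤ |c₁| * x := by gcongr; exact le_abs_self _
  have h4 : c₀ ≤ |c₀| * x := (le_abs_self _).trans (le_mul_of_one_le_right (abs_nonneg _) hx1)
  nlinarith

lemma slope_nonneg_of_linear_nonneg {c₀ c₁ : ℝ}
    (h : ∀ x : ℝ, 0 ≤ x → 0 ≤ c₀ + c₁ * x) : 0 ≤ c₁ := by
  refine leading_coeff_nonneg_of_quadratic_nonneg (c₀ := c₀) (c₁ := 0) fun x _ => ?_
  have := h (x ^ 2) (by positivity)
  linarith

/-- Leibniz rule for `q * (1 / q) = 1` with `q` quadratic. -/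
lemma iteratedDeriv_one_div_quadratic (q₀ q₁ q₂ : ℝ) (n : ℕ) :
    ∀ x : ℝ, q₀ + q₁ * x + q₂ * x ^ 2 ≠ 0 →
      (q₀ + q₁ * x + q₂ * x ^ 2) *
          iteratedDeriv (n + 1) (fun u : ℝ => 1 / (q₀ + q₁ * u + q₂ * u ^ 2)) x +
        (n + 1) * (q₁ + 2 * q₂ * x) *
          iteratedDeriv n (fun u : ℝ => 1 / (q₀ + q₁ * u + q₂ * u ^ 2)) x +
        (n + 1) * n * q₂ *
          iteratedDeriv (n - 1) (fun u : ℝ => 1 / (q₀ + q₁ * u + q₂ * u ^ 2)) x = 0 := by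
  set f : ℝ → ℝ := fun u => 1 / (q₀ + q₁ * u + q₂ * u ^ 2) with hf
  have hq (x : ℝ) : HasDerivAt (fun x : ℝ => q₀ + q₁ * x + q₂ * x ^ 2) (q₁ + 2 * q₂ * x) x := by
    have := ((hasDerivAt_id x).const_mul q₁).const_add q₀ |>.add
      ((hasDerivAt_pow 2 x).const_mul q₂)
    refine this.congr_deriv ?_
    simp; ring
  have hq' (x : ℝ) : HasDerivAt (fun x : ℝ => q₁ + 2 * q₂ * x) (2 * q₂) x := by
    simpa using ((hasDerivAt_id x).const_mul (2 * q₂)).const_add q₁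
  have hD (m : ℕ) (x : ℝ) (hx : q₀ + q₁ * x + q₂ * x ^ 2 ≠ 0) :
      HasDerivAt (iteratedDeriv m f) (iteratedDeriv (m + 1) f x) x := by
    have hs : ContDiffAt ℝ (m + 1 : ℕ) f x :=
      contDiffAt_const.div (by fun_prop) hx
    rw [iteratedDeriv_succ]
    have hd := hs.contDiffWithinAt (s := Set.univ)
      |>.differentiableWithinAt_iteratedDerivWithin (m := m)
        (by exact_mod_cast Nat.lt_succ_self m) (by simp)
    rw [iteratedDerivWithin_univ, differentiableWithinAt_univ] at hd
    exact hd.hasDerivAt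
  induction n with
  | zero =>
    intro x hx
    have h1 := (hq x).fun_mul (hD 0 x hx)
    have hev : (fun x => (q₀ + q₁ * x + q₂ * x ^ 2) * iteratedDeriv 0 f x) =ᶠ[nhds x]
        fun _ => 1 := by
      filter_upwards [(hq x).continuousAt.eventually_ne hx] with u hu
      simpa [hf] using mul_inv_cancel₀ hu
    have h2 := h1.unique ((hasDerivAt_const x (1 : ℝ)).congr_of_eventuallyEq hev)
    push_cast
    linarith
  | succ n ih =>
    intro x hx
    have h1 := (((hq x).fun_mul (hD (n + 1) x hx)).fun_add
      (((hq' x).const_mul ((n : ℝ) + 1)).fun_mul (hD n x hx))).fun_add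
      ((hD (n - 1) x hx).const_mul (((n : ℝ) + 1) * n * q₂))
    have hev := (hq x).continuousAt.eventually_ne hx |>.mono ih
    have h2 := h1.unique ((hasDerivAt_const x (0 : ℝ)).congr_of_eventuallyEq hev)
    rcases n with _ | n
    · simp only [Nat.cast_zero, Nat.cast_one, zero_add] at h2 ⊢
      norm_num at h2 ⊢
      linarith
    · simp only [Nat.add_sub_cancel] at h2 ⊢
      push_cast at h2 ⊢
      linarith

/-- A nonnegative solution of a three-term recurrence forces a nonnegative discriminant. -/
lemma discrim_nonneg_of_recurrence_nonneg {q₀ q₁ q₂ : ℝ} (h0 : 0 < q₀) {u : ℕ → ℝ}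
    (hu0 : 0 < u 0) (hu : ∀ n, 0 ≤ u n)
    (hrec : ∀ n, q₀ * u (n + 2) = q₁ * u (n + 1) - q₂ * u n) :
    4 * q₀ * q₂ ≤ q₁ ^ 2 := by
  rcases le_or_gt q₂ 0 with h2 | h2
  · nlinarith [sq_nonneg q₁, mul_nonneg h0.le (neg_nonneg.2 h2)]
  by_contra! hlt
  have hupos (n : ℕ) : 0 < u n := by
    induction n with
    | zero => exact hu0
    | succ n ih =>
      refine (hu _).lt_of_ne' fun h => ?_
      have h3 := hrec n
      rw [h] at h3
      nlinarith [mul_nonneg h0.le (hu (n + 2)), mul_pos h2 ih]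
  obtain ⟨s, hs, rfl⟩ : ∃ s, 0 < s ∧ s ^ 2 = q₀ := ⟨√q₀, Real.sqrt_pos.2 h0, Real.sq_sqrt h0.le⟩
  obtain ⟨t, ht, rfl⟩ : ∃ t, 0 < t ∧ t ^ 2 = q₂ := ⟨√q₂, Real.sqrt_pos.2 h2, Real.sq_sqrt h2.le⟩
  have hst : q₁ < 2 * s * t := lt_of_pow_lt_pow_left₀ 2 (by positivity) (by linarith)
  have hstep (n : ℕ) : u (n + 2) / u (n + 1) ≤ u (n + 1) / u n - (2 * s * t - q₁) / s ^ 2 := by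
    have hn := hupos n
    have hn1 := hupos (n + 1)
    have hr : u (n + 2) = (q₁ * u (n + 1) - t ^ 2 * u n) / s ^ 2 := by
      rw [← hrec n]; field_simp
    have key : u (n + 1) / u n - (2 * s * t - q₁) / s ^ 2 - u (n + 2) / u (n + 1)
        = (s * u (n + 1) - t * u n) ^ 2 / (s ^ 2 * u n * u (n + 1)) := by
      rw [hr]; field_simp; ring
    have : 0 ≤ (s * u (n + 1) - t * u n) ^ 2 / (s ^ 2 * u n * u (n + 1)) := by positivity
    linarith
  have hlin (n : ℕ) : u (n + 1) / u n ≤ u 1 / u 0 - n * ((2 * s * t - q₁) / s ^ 2) := by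
    induction n with
    | zero => simp
    | succ n ih =>
      have := hstep n
      push_cast
      linarith
  have hε : 0 < (2 * s * t - q₁) / s ^ 2 := div_pos (by linarith) h0
  obtain ⟨n, hn⟩ := Archimedean.arch (u 1 / u 0) hε
  rw [nsmul_eq_mul] at hn
  have := hlin n
  have := div_pos (hupos (n + 1)) (hupos n)
  linarith

lemma coeffs_of_one_div_quadratic {q₀ q₁ q₂ : ℝ} (h0 : 0 < q₀)
    (h : ∀ n : ℕ, 0 ≤ (-1 : ℝ) ^ n *
      iteratedDeriv n (fun u : ℝ => 1 / (q₀ + q₁ * u + q₂ * u ^ 2)) 0) :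
    0 ≤ q₁ ∧ 4 * q₀ * q₂ ≤ q₁ ^ 2 := by
  have hL (n : ℕ) := iteratedDeriv_one_div_quadratic q₀ q₁ q₂ n 0 (by simpa using h0.ne')
  set f : ℝ → ℝ := fun u => 1 / (q₀ + q₁ * u + q₂ * u ^ 2) with hf
  have hf0 : iteratedDeriv 0 f 0 = 1 / q₀ := by simp [hf]
  constructor
  · have h1 := hL 0
    have h2 := h 1
    rw [hf0] at h1
    simp only [mul_zero, ne_eq, OfNat.ofNat_ne_zero, not_false_eq_true, zero_pow, add_zero,
      Nat.cast_zero, zero_add, one_mul, zero_mul, pow_one, neg_mul] at h1 h2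
    have h3 : q₁ = q₀ * (q₀ * -iteratedDeriv 1 f 0) := by
      field_simp at h1
      linarith
    rw [h3]
    positivity
  · refine discrim_nonneg_of_recurrence_nonneg h0
      (u := fun n => (-1 : ℝ) ^ n * iteratedDeriv n f 0 / n.factorial) ?_ ?_ ?_
    · simp only [hf0]
      simp [h0]
    · intro n
      exact div_nonneg (h n) (by positivity)
    · intro n
      have h1 := hL (n + 1)
      simp only [mul_zero, ne_eq, OfNat.ofNat_ne_zero, not_false_eq_true, zero_pow, add_zero,
        Nat.add_sub_cancel] at h1
      have hn : (n.factorial : ℝ) ≠ 0 := by positivity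
      simp only [Nat.factorial_succ, pow_succ]
      push_cast at h1 ⊢
      have h2 : q₀ * iteratedDeriv (n + 2) f 0 = -((n + 1 + 1) * q₁ * iteratedDeriv (n + 1) f 0) -
        (n + 1 + 1) * (n + 1) * q₂ * iteratedDeriv n f 0 := by linarith
      field_simp
      linear_combination h2

lemma exists_factorization_of_discrim_nonneg {A B C : ℝ} (hA : 0 < A) (hB : 0 ≤ B) (hC : 0 ≤ C)
    (hdisc : 4 * C * A ≤ B ^ 2) :
    ∃ s t : ℝ, 0 ≤ s ∧ 0 ≤ t ∧ A * (s + t) = B ∧ A * (s * t) = C := by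
  obtain ⟨r, hr, hr2⟩ : ∃ r, 0 ≤ r ∧ r ^ 2 = B ^ 2 - 4 * C * A :=
    ⟨√(B ^ 2 - 4 * C * A), Real.sqrt_nonneg _, Real.sq_sqrt (by linarith)⟩
  have hrB : r ≤ B := le_of_sq_le_sq (by nlinarith) hB
  refine ⟨(B - r) / (2 * A), (B + r) / (2 * A), div_nonneg (by linarith) (by linarith),
    by positivity, by field_simp; ring, ?_⟩
  field_simp
  linarith

lemma im_eq_zero_and_re_eq_of_isRoot_map_mul {p : ℝ[X]} {A s t : ℝ} (hA : A ≠ 0)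
    (hp : p = C A * (X + C s) * (X + C t)) {z : ℂ}
    (hz : (p.map (algebraMap ℝ ℂ)).IsRoot z) : z.im = 0 ∧ (z.re = -s ∨ z.re = -t) := by
  subst hp
  simp only [IsRoot.def, eval_map_algebraMap, map_mul, map_add, aeval_C, aeval_X,
    Complex.coe_algebraMap, mul_eq_zero, Complex.ofReal_eq_zero, hA, false_or] at hz
  rcases hz with hz | hz <;> rw [eq_neg_of_add_eq_zero_left hz] <;> simp

theorem statement13 (a b : Polynomial ℝ)
    (hbdeg : b.natDegree = 2) (hadeg : a.natDegree ≤ 2) (hane : a ≠ 0)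
    (hpos : ∀ x y : ℝ, 0 ≤ x → 0 ≤ y → 0 < b.eval x + a.eval x * y)
    (hjcm : JointCompMonoFun (fun x y => 1 / (b.eval x + a.eval x * y))) :
    ((∀ x : ℝ, 0 ≤ x → 0 ≤ a.eval x) ∧ 1 ≤ a.natDegree ∧
      (∀ z : ℂ, (a.map (algebraMap ℝ ℂ)).IsRoot z → z.im = 0 ∧ z.re ≤ 0)) ∧
    ((∀ x : ℝ, 0 ≤ x → 0 < b.eval x) ∧
      (∀ z : ℂ, (b.map (algebraMap ℝ ℂ)).IsRoot z → z.im = 0 ∧ z.re < 0)) ∧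
    ((∃ a₀ b₀ a₁ a₂ b₁ b₂ : ℝ, 0 < a₀ ∧ 0 < b₀ ∧ 0 < b₁ ∧ 0 < b₂ ∧ 0 ≤ a₁ ∧ 0 ≤ a₂ ∧
        ∀ x y : ℝ, b.eval x + a.eval x * y =
          b₀ * (x + b₁) * (x + b₂) + a₀ * (x + a₁) * (x + a₂) * y) ∨
      (∃ a₀ b₀ a₁ b₁ b₂ : ℝ, 0 < a₀ ∧ 0 < b₀ ∧ 0 < b₁ ∧ 0 < b₂ ∧ 0 ≤ a₁ ∧
        ∀ x y : ℝ, b.eval x + a.eval x * y =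
          b₀ * (x + b₁) * (x + b₂) + a₀ * (x + a₁) * y)) := by
  have hbev (x : ℝ) : b.eval x = b.coeff 0 + b.coeff 1 * x + b.coeff 2 * x ^ 2 := by
    rw [eval_eq_sum_range' (n := 3) (by omega)]; simp [Finset.sum_range_succ]
  have haev (x : ℝ) : a.eval x = a.coeff 0 + a.coeff 1 * x + a.coeff 2 * x ^ 2 := by
    rw [eval_eq_sum_range' (n := 3) (by omega)]; simp [Finset.sum_range_succ]
  have ha_nonneg (x : ℝ) (hx : 0 ≤ x) : 0 ≤ a.eval x :=
    slope_nonneg_of_linear_nonneg fun y hy => (hpos x y hx hy).le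
  have hb_pos (x : ℝ) (hx : 0 ≤ x) : 0 < b.eval x := by simpa using hpos x 0 hx le_rfl
  have hb2 : 0 < b.coeff 2 := by
    refine lt_of_le_of_ne (leading_coeff_nonneg_of_quadratic_nonneg
      fun x hx => hbev x ▸ (hb_pos x hx).le) fun h => ?_
    have : b.leadingCoeff = 0 := by rw [leadingCoeff, hbdeg, ← h]
    simp [leadingCoeff_eq_zero.1 this] at hbdeg
  have hb0 : 0 < b.coeff 0 := by simpa [hbev] using hb_pos 0 le_rfl
  have ha0 : 0 ≤ a.coeff 0 := by simpa [haev] using ha_nonneg 0 le_rfl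
  have ha2 : 0 ≤ a.coeff 2 :=
    leading_coeff_nonneg_of_quadratic_nonneg fun x hx => haev x ▸ ha_nonneg x hx
  have hkey (y : ℝ) (hy : 0 ≤ y) : 0 ≤ b.coeff 1 + a.coeff 1 * y ∧
      4 * (b.coeff 0 + a.coeff 0 * y) * (b.coeff 2 + a.coeff 2 * y) ≤
        (b.coeff 1 + a.coeff 1 * y) ^ 2 := by
    refine coeffs_of_one_div_quadratic (by positivity) fun n => ?_
    have h := hjcm n 0 0 y le_rfl hy
    rw [Function.iterate_zero_apply, pd1_iterate_eq_iteratedDeriv, add_zero] at h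
    convert h using 4 with u
    rw [hbev, haev]
    ring
  have hb1 : 0 ≤ b.coeff 1 := by simpa using (hkey 0 le_rfl).1
  have ha1 : 0 ≤ a.coeff 1 := slope_nonneg_of_linear_nonneg fun y hy => (hkey y hy).1
  have hadisc : 4 * a.coeff 0 * a.coeff 2 ≤ a.coeff 1 ^ 2 := by
    have := leading_coeff_nonneg_of_quadratic_nonneg
      (c₀ := b.coeff 1 ^ 2 - 4 * b.coeff 0 * b.coeff 2)
      (c₁ := 2 * b.coeff 1 * a.coeff 1 - 4 * a.coeff 0 * b.coeff 2 - 4 * b.coeff 0 * a.coeff 2)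
      (c₂ := a.coeff 1 ^ 2 - 4 * a.coeff 0 * a.coeff 2) fun y hy => by
        linarith [(hkey y hy).2]
    linarith
  have hadeg1 : 1 ≤ a.natDegree := by
    by_contra! hd
    have h1 : a.coeff 1 = 0 := coeff_eq_zero_of_natDegree_lt hd
    have h2 : a.coeff 2 = 0 := coeff_eq_zero_of_natDegree_lt (by omega)
    have h0 : a.coeff 0 ≠ 0 := fun h0 => hane <| by
      rw [eq_C_of_natDegree_eq_zero (by omega : a.natDegree = 0), h0, C_0]
    have := slope_nonneg_of_linear_nonneg (c₀ := b.coeff 1 ^ 2 - 4 * b.coeff 0 * b.coeff 2)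
      (c₁ := -4 * a.coeff 0 * b.coeff 2) fun y hy => by
        have := (hkey y hy).2
        rw [h1, h2] at this
        linarith
    nlinarith [mul_pos (lt_of_le_of_ne ha0 h0.symm) hb2]
  obtain ⟨b₁, b₂, hb₁, hb₂, hbsum, hbprod⟩ := exists_factorization_of_discrim_nonneg hb2 hb1 hb0.le
    (by simpa using (hkey 0 le_rfl).2)
  have hb₁' : 0 < b₁ := hb₁.lt_of_ne (by rintro rfl; simp at hbprod; linarith)
  have hb₂' : 0 < b₂ := hb₂.lt_of_ne (by rintro rfl; simp at hbprod; linarith)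
  have hbfac : b = C (b.coeff 2) * (X + C b₁) * (X + C b₂) := by
    refine Polynomial.funext fun x => ?_
    simp only [hbev x, eval_mul, eval_add, eval_C, eval_X]
    linear_combination -hbprod - x * hbsum
  have hbroot (z : ℂ) (hz : (b.map (algebraMap ℝ ℂ)).IsRoot z) : z.im = 0 ∧ z.re < 0 := by
    obtain ⟨h, h' | h'⟩ := im_eq_zero_and_re_eq_of_isRoot_map_mul hb2.ne' hbfac hz <;>
      exact ⟨h, by linarith⟩
  rcases ha2.eq_or_lt with h2 | h2
  · have ha1' : 0 < a.coeff 1 := by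
      refine ha1.lt_of_ne fun h1 => ?_
      have hlead : a.coeff a.natDegree ≠ 0 := by simpa using hane
      obtain hd | hd : a.natDegree = 1 ∨ a.natDegree = 2 := by omega
      · exact hlead (by rw [hd, ← h1])
      · exact hlead (by rw [hd, ← h2])
    have haeval (x : ℝ) : a.eval x = a.coeff 1 * (x + a.coeff 0 / a.coeff 1) := by
      rw [haev, ← h2]; field_simp; ring
    have hafac : a = C (a.coeff 1) * (X + C (a.coeff 0 / a.coeff 1)) := by
      refine Polynomial.funext fun x => ?_
      simp only [haeval x, eval_mul, eval_add, eval_C, eval_X]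
    have hs : 0 ≤ a.coeff 0 / a.coeff 1 := by positivity
    refine ⟨⟨ha_nonneg, hadeg1, fun z hz => ?_⟩, ⟨hb_pos, hbroot⟩, Or.inr
      ⟨a.coeff 1, b.coeff 2, a.coeff 0 / a.coeff 1, b₁, b₂, ha1', hb2, hb₁', hb₂', hs,
        fun x y => ?_⟩⟩
    · rw [hafac] at hz
      simp only [IsRoot.def, eval_map_algebraMap, map_mul, map_add, aeval_C, aeval_X,
        Complex.coe_algebraMap, mul_eq_zero, Complex.ofReal_eq_zero, ha1'.ne', false_or] at hz
      rw [eq_neg_of_add_eq_zero_left hz, ← Complex.ofReal_neg]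
      exact ⟨Complex.ofReal_im _, by rw [Complex.ofReal_re]; linarith⟩
    · rw [hbev, haeval]
      linear_combination -hbprod - x * hbsum
  · obtain ⟨a₁, a₂, ha₁, ha₂, hasum, haprod⟩ :=
      exists_factorization_of_discrim_nonneg h2 ha1 ha0 hadisc
    have hafac : a = C (a.coeff 2) * (X + C a₁) * (X + C a₂) := by
      refine Polynomial.funext fun x => ?_
      simp only [haev x, eval_mul, eval_add, eval_C, eval_X]
      linear_combination -haprod - x * hasum
    refine ⟨⟨ha_nonneg, hadeg1, fun z hz => ?_⟩, ⟨hb_pos, hbroot⟩, Or.inl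
      ⟨a.coeff 2, b.coeff 2, a₁, a₂, b₁, b₂, h2, hb2, hb₁', hb₂', ha₁, ha₂, fun x y => ?_⟩⟩
    · obtain ⟨h, h' | h'⟩ := im_eq_zero_and_re_eq_of_isRoot_map_mul h2.ne' hafac hz <;>
        exact ⟨h, by linarith⟩
    · rw [hbev, haev]
      linear_combination -hbprod - x * hbsum - y * haprod - x * y * hasum
end
end

section
/- Let a_0, b_0, a_1, a_2, b_1, b_2 be positive real numbers with a_1 ≤ a_2 and b_1 ≤ b_2, and set a(x) = a_0·(x+a_1)(x+a_2) and b(x) = b_0·(x+b_1)(x+b_2) for x ≥ 0. If (b_1 ≤ a_1 ≤ b_2 or b_1 ≤ a_2 ≤ b_2) and b_1 + b_2 ≤ a_1 + a_2, then the double net {1/(b(m) + a(m)·n)}_{m,n ∈ ℤ₊} is a minimal joint completely monotone net. -/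
noncomputable section

/-- A completely monotone sequence is minimal. -/
def MinCompMono (s : ℕ → ℝ) : Prop :=
  CompMono s ∧ ∀ ε : ℝ, 0 < ε → ¬ CompMono (fun k => s k - if k = 0 then ε else 0)

/-- The negated forward difference as a linear operator on sequences. -/
def negDiff : (ℕ → ℝ) →ₗ[ℝ] (ℕ → ℝ) where
  toFun s m := s m - s (m + 1)
  map_add' s t := by ext m; simp only [Pi.add_apply]; ring
  map_smul' c s := by ext m; simp only [Pi.smul_apply, smul_eq_mul, RingHom.id_apply]; ring

lemma negDiff_apply (s : ℕ → ℝ) (m : ℕ) : negDiff s m = s m - s (m + 1) := rfl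

lemma negDiff_pow_succ_apply (k : ℕ) (s : ℕ → ℝ) (m : ℕ) :
    (negDiff ^ (k + 1)) s m = (negDiff ^ k) s m - (negDiff ^ k) s (m + 1) := by
  rw [pow_succ', Module.End.mul_apply, negDiff_apply]

lemma negDiff_pow_eq (k : ℕ) (s : ℕ → ℝ) (m : ℕ) :
    (negDiff ^ k) s m = (-1 : ℝ) ^ k * dSeq^[k] s m := by
  induction k generalizing m with
  | zero => simp
  | succ k ih =>
    rw [negDiff_pow_succ_apply, ih, ih, Function.iterate_succ_apply', dSeq, pow_succ]
    ring

lemma compMono_iff (s : ℕ → ℝ) : CompMono s ↔ ∀ k m : ℕ, 0 ≤ (negDiff ^ k) s m := by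
  simp only [CompMono, negDiff_pow_eq]

lemma negDiff_pow_shift (k : ℕ) (s : ℕ → ℝ) (m : ℕ) :
    (negDiff ^ k) (fun i => s (i + 1)) m = (negDiff ^ k) s (m + 1) := by
  induction k generalizing m with
  | zero => rfl
  | succ k ih => rw [negDiff_pow_succ_apply, negDiff_pow_succ_apply, ih, ih]

namespace CompMono

variable {s t : ℕ → ℝ}

lemma add (hs : CompMono s) (ht : CompMono t) : CompMono (s + t) := by
  rw [compMono_iff] at *
  intro k m
  rw [map_add]
  exact add_nonneg (hs k m) (ht k m)

lemma smul (hs : CompMono s) {c : ℝ} (hc : 0 ≤ c) : CompMono (c • s) := by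
  rw [compMono_iff] at *
  intro k m
  rw [map_smul]
  exact mul_nonneg hc (hs k m)

lemma shift (hs : CompMono s) : CompMono (fun i => s (i + 1)) := by
  rw [compMono_iff] at *
  intro k m
  rw [negDiff_pow_shift]
  exact hs k (m + 1)

lemma negDiff (hs : CompMono s) : CompMono (negDiff s) := by
  rw [compMono_iff] at *
  intro k m
  rw [← Module.End.mul_apply, ← pow_succ]
  exact hs (k + 1) m

lemma mul (hs : CompMono s) (ht : CompMono t) : CompMono (s * t) := by
  rw [compMono_iff]
  intro k
  induction k generalizing s t with
  | zero =>
    intro m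
    rw [compMono_iff] at hs ht
    exact mul_nonneg (hs 0 m) (ht 0 m)
  | succ k ih =>
    intro m
    have h : _root_.negDiff (s * t)
        = _root_.negDiff s * (fun i => t (i + 1)) + s * _root_.negDiff t := by
      ext i
      simp only [negDiff_apply, Pi.mul_apply, Pi.add_apply]
      ring
    rw [pow_succ, Module.End.mul_apply, h, map_add]
    exact add_nonneg (ih hs.negDiff ht.shift m) (ih hs ht.negDiff m)

end CompMono

lemma compMono_const {c : ℝ} (hc : 0 ≤ c) : CompMono (fun _ => c) := by
  rw [compMono_iff]
  rintro (_ | k) m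
  · exact hc
  · have h : negDiff (fun _ => c) = 0 := by
      ext i
      simp [negDiff_apply]
    rw [pow_succ, Module.End.mul_apply, h, map_zero]
    rfl

lemma compMono_prod {ι : Type*} (I : Finset ι) (f : ι → ℕ → ℝ) (h : ∀ i ∈ I, CompMono (f i)) :
    CompMono (∏ i ∈ I, f i) := by
  classical
  induction I using Finset.induction_on with
  | empty => exact compMono_const zero_le_one
  | insert i I hi ih =>
    rw [Finset.prod_insert hi]
    exact (h i (Finset.mem_insert_self _ _)).mul
      (ih fun j hj => h j (Finset.mem_insert_of_mem hj))

lemma negDiff_pow_one_div_affine {a b : ℝ} (ha : 0 ≤ a) (hb : 0 < b) (k n : ℕ) :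
    (negDiff ^ k) (fun i : ℕ => 1 / (b + a * i)) n
      = k.factorial * a ^ k / ∏ j ∈ Finset.range (k + 1), (b + a * (n + j : ℕ)) := by
  induction k generalizing n with
  | zero => simp
  | succ k ih =>
    rw [negDiff_pow_succ_apply, ih, ih]
    have hpos : ∀ i : ℕ, 0 < b + a * i := fun i => by positivity
    have hP : ∀ n : ℕ, 0 < ∏ j ∈ Finset.range (k + 1), (b + a * (n + j : ℕ)) :=
      fun n => Finset.prod_pos fun j _ => hpos _
    have h1 := Finset.prod_range_succ (fun j => b + a * (n + j : ℕ)) (k + 1)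
    have h2 := Finset.prod_range_succ' (fun j => b + a * (n + j : ℕ)) (k + 1)
    have h3 : ∏ j ∈ Finset.range (k + 1), (b + a * (n + (j + 1) : ℕ))
        = ∏ j ∈ Finset.range (k + 1), (b + a * (n + 1 + j : ℕ)) :=
      Finset.prod_congr rfl fun j _ => by rw [add_comm j 1, add_assoc]
    rw [h3] at h2
    have hA := hP n
    have hB := hP (n + 1)
    rw [h1] at h2 ⊢
    generalize ∏ j ∈ Finset.range (k + 1), (b + a * (n + j : ℕ)) = A at *
    generalize ∏ j ∈ Finset.range (k + 1), (b + a * (n + 1 + j : ℕ)) = B at *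
    rw [Nat.factorial_succ]
    push_cast at *
    rw [div_sub_div _ _ hA.ne' hB.ne', div_eq_div_iff (by positivity) (by positivity)]
    simp only [add_zero] at h2
    linear_combination -((k.factorial : ℝ) * a ^ k * A) * h2

lemma compMono_one_div_affine {a b : ℝ} (ha : 0 ≤ a) (hb : 0 < b) :
    CompMono (fun i : ℕ => 1 / (b + a * i)) := by
  rw [compMono_iff]
  intro k m
  rw [negDiff_pow_one_div_affine ha hb]
  exact div_nonneg (by positivity) (Finset.prod_nonneg fun j _ => by positivity)

lemma compMono_one_div_add {c : ℝ} (hc : 0 < c) : CompMono (fun i : ℕ => 1 / ((i : ℝ) + c)) := by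
  simpa [add_comm] using compMono_one_div_affine zero_le_one hc

lemma negDiff_pow_indicator_zero (ε : ℝ) (k : ℕ) :
    (negDiff ^ k) (fun i => if i = 0 then ε else 0) 0 = ε ∧
      ∀ m, (negDiff ^ k) (fun i => if i = 0 then ε else 0) (m + 1) = 0 := by
  induction k with
  | zero => simp
  | succ k ih =>
    simp only [negDiff_pow_succ_apply, ih.1, ih.2, sub_zero, implies_true, and_self]

lemma one_add_sum_le_prod_div {a b : ℝ} (ha : 0 < a) (hb : 0 < b) (k : ℕ) :
    b * (b / a * ∑ j ∈ Finset.range k, 1 / ((j : ℝ) + 1))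
      ≤ (∏ j ∈ Finset.range (k + 1), (b + a * (j : ℕ))) / (k.factorial * a ^ k) := by
  suffices h : b * (1 + b / a * ∑ j ∈ Finset.range k, 1 / ((j : ℝ) + 1))
      ≤ (∏ j ∈ Finset.range (k + 1), (b + a * (j : ℕ))) / (k.factorial * a ^ k) by
    linarith
  induction k with
  | zero => simp
  | succ k ih =>
    have hS : 0 ≤ ∑ j ∈ Finset.range k, 1 / ((j : ℝ) + 1) :=
      Finset.sum_nonneg fun j _ => by positivity
    rw [Finset.prod_range_succ, Finset.sum_range_succ, Nat.factorial_succ]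
    have e : (∏ j ∈ Finset.range (k + 1), (b + a * (j : ℕ))) * (b + a * (k + 1 : ℕ))
          / (((k + 1) * k.factorial : ℕ) * a ^ (k + 1))
        = (∏ j ∈ Finset.range (k + 1), (b + a * (j : ℕ))) / (k.factorial * a ^ k)
          * (1 + b / a * (1 / ((k : ℝ) + 1))) := by
      have : (k.factorial : ℝ) ≠ 0 := by positivity
      push_cast
      field_simp
      ring
    rw [e]
    refine le_trans ?_ (mul_le_mul_of_nonneg_right ih (by positivity))
    have : 0 ≤ b * (b / a * ∑ j ∈ Finset.range k, 1 / ((j : ℝ) + 1))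
        * (b / a * (1 / ((k : ℝ) + 1))) := by positivity
    nlinarith

lemma not_compMono_one_div_affine_sub {a b : ℝ} (ha : 0 < a) (hb : 0 < b) {ε : ℝ} (hε : 0 < ε) :
    ¬ CompMono ((fun i : ℕ => 1 / (b + a * i)) - fun i => if i = 0 then ε else 0) := by
  intro h
  rw [compMono_iff] at h
  obtain ⟨k, hk⟩ := (Real.tendsto_sum_range_one_div_nat_succ_atTop.eventually_gt_atTop
    (1 / ε / b / (b / a))).exists
  have h0 := h k 0
  rw [map_sub, Pi.sub_apply, negDiff_pow_one_div_affine ha.le hb,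
    (negDiff_pow_indicator_zero ε k).1] at h0
  simp only [zero_add] at h0
  have h1 := one_add_sum_le_prod_div ha hb k
  have hP : 0 < ∏ j ∈ Finset.range (k + 1), (b + a * (j : ℕ)) :=
    Finset.prod_pos fun j _ => by positivity
  rw [div_lt_iff₀ (by positivity), div_lt_iff₀ (by positivity), div_lt_iff₀ hε] at hk
  rw [sub_nonneg, le_div_iff₀ hP] at h0
  have hF : 0 < (k.factorial : ℝ) * a ^ k := by positivity
  rw [le_div_iff₀ hF] at h1
  nlinarith

lemma not_compMono_one_div_quadratic_sub {b₀ b₁ b₂ : ℝ} (hb₀ : 0 < b₀) (hb₁ : 0 < b₁)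
    (hb : b₁ ≤ b₂) {ε : ℝ} (hε : 0 < ε) :
    ¬ CompMono ((fun i : ℕ => 1 / (b₀ * ((i : ℝ) + b₁) * ((i : ℝ) + b₂)))
      - fun i => if i = 0 then ε else 0) := by
  intro h
  have hb₂ : 0 < b₂ := hb₁.trans_le hb
  have hd : 0 < b₂ - b₁ / 2 := by linarith
  have h1 : CompMono ((b₀ * (b₂ - b₁ / 2)) •
      (((fun i : ℕ => 1 / (b₀ * ((i : ℝ) + b₁) * ((i : ℝ) + b₂)))
        - fun i => if i = 0 then ε else 0) +
      ((1 / (b₀ * (b₂ - b₁ / 2))) • (fun i : ℕ => 1 / ((i : ℝ) + b₂)) +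
      (b₁ / 2 / b₀) • ((fun i : ℕ => 1 / ((i : ℝ) + b₁ / 2)) *
        ((fun i : ℕ => 1 / ((i : ℝ) + b₁)) * (fun i : ℕ => 1 / ((i : ℝ) + b₂))))))) :=
    (h.add (((compMono_one_div_add hb₂).smul (by positivity)).add
      (((compMono_one_div_add (half_pos hb₁)).mul
        ((compMono_one_div_add hb₁).mul (compMono_one_div_add hb₂))).smul
          (by positivity)))).smul (by positivity)
  refine not_compMono_one_div_affine_sub one_pos (half_pos hb₁)
    (ε := b₀ * (b₂ - b₁ / 2) * ε) (by positivity) ?_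
  convert h1 using 1
  ext i
  simp only [Pi.sub_apply, Pi.smul_apply, Pi.add_apply, Pi.mul_apply, smul_eq_mul]
  have e : 1 / (b₁ / 2 + 1 * (i : ℝ)) = b₀ * (b₂ - b₁ / 2) *
      (1 / (b₀ * ((i : ℝ) + b₁) * ((i : ℝ) + b₂)) + (1 / (b₀ * (b₂ - b₁ / 2)) * (1 / ((i : ℝ) + b₂)) +
      b₁ / 2 / b₀ * (1 / ((i : ℝ) + b₁ / 2) * (1 / ((i : ℝ) + b₁) * (1 / ((i : ℝ) + b₂)))))) := by
    have x1 : (i : ℝ) + b₁ ≠ 0 := by positivity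
    have x2 : (i : ℝ) + b₂ ≠ 0 := by positivity
    have x3 : (i : ℝ) + b₁ / 2 ≠ 0 := by positivity
    generalize hD : b₂ - b₁ / 2 = D at *
    obtain rfl : b₂ = D + b₁ / 2 := by linarith
    rw [show b₁ / 2 + 1 * (i : ℝ) = i + b₁ / 2 by ring]
    field_simp
    ring
  rw [e]
  split_ifs <;> ring

lemma exists_factorization {a₀ b₀ a₁ a₂ b₁ b₂ s : ℝ} (ha₀ : 0 < a₀) (hb₀ : 0 < b₀)
    (hb₁ : 0 < b₁) (ha : a₁ ≤ a₂) (h₁ : b₁ ≤ a₁) (h₂ : a₁ ≤ b₂)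
    (hsum : b₁ + b₂ ≤ a₁ + a₂) (hs : 0 ≤ s) :
    ∃ c₁ c₂ : ℝ, 0 < c₁ ∧ c₁ ≤ a₁ ∧ 0 < c₂ ∧ c₁ + c₂ ≤ a₁ + a₂ ∧
      ∀ x : ℝ, b₀ * (x + b₁) * (x + b₂) + a₀ * (x + a₁) * (x + a₂) * s
        = (b₀ + a₀ * s) * (x + c₁) * (x + c₂) := by
  have hL : 0 < b₀ + a₀ * s := by positivity
  obtain ⟨c, ⟨hc₁, hc₂⟩, hc⟩ : (0 : ℝ) ∈
      (fun x : ℝ => b₀ * (-x + b₁) * (-x + b₂) + a₀ * (-x + a₁) * (-x + a₂) * s) ''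
        Set.Icc b₁ a₁ := by
    refine intermediate_value_Icc' h₁ (Continuous.continuousOn (by fun_prop)) ⟨?_, ?_⟩
    · have : 0 ≤ b₀ * (a₁ - b₁) * (b₂ - a₁) :=
        mul_nonneg (mul_nonneg hb₀.le (by linarith)) (by linarith)
      nlinarith
    · have : 0 ≤ a₀ * (a₁ - b₁) * (a₂ - b₁) * s :=
        mul_nonneg (mul_nonneg (mul_nonneg ha₀.le (by linarith)) (by linarith)) hs
      nlinarith
  simp only at hc
  set S := (b₀ * (b₁ + b₂) + a₀ * s * (a₁ + a₂)) / (b₀ + a₀ * s) with hS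
  have hS' : S * (b₀ + a₀ * s) = b₀ * (b₁ + b₂) + a₀ * s * (a₁ + a₂) :=
    div_mul_cancel₀ _ hL.ne'
  have hfac : ∀ x : ℝ, b₀ * (x + b₁) * (x + b₂) + a₀ * (x + a₁) * (x + a₂) * s
        = (b₀ + a₀ * s) * (x + c) * (x + (S - c)) := by
    intro x
    linear_combination hc - (x + c) * hS'
  have hc0 : 0 < c := hb₁.trans_le hc₁
  have hb₂ : 0 < b₂ := by linarith
  have ha₁ : 0 < a₁ := by linarith
  have ha₂ : 0 < a₂ := by linarith
  refine ⟨c, S - c, hc0, hc₂, ?_, ?_, hfac⟩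
  · have h0 := hfac 0
    simp only [zero_add] at h0
    have : 0 < (b₀ + a₀ * s) * c * (S - c) := by
      rw [← h0]
      positivity
    exact pos_of_mul_pos_right this (by positivity)
  · rw [add_sub_cancel, hS, div_le_iff₀ hL]
    nlinarith

lemma compMono_quadratic_ratio {a₁ a₂ c₁ c₂ : ℝ} (ha : a₁ ≤ a₂) (hc₁ : 0 < c₁) (h : c₁ ≤ a₁)
    (hc₂ : 0 < c₂) (hsum : c₁ + c₂ ≤ a₁ + a₂) :
    CompMono (fun i : ℕ => ((i : ℝ) + a₁) * (i + a₂) / ((i + c₁) * (i + c₂))) := by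
  have h1 := (compMono_const zero_le_one).add
    (((compMono_one_div_add hc₂).smul (sub_nonneg.2 hsum)).add
      (((compMono_one_div_add hc₁).mul (compMono_one_div_add hc₂)).smul
        (mul_nonneg (sub_nonneg.2 h) (sub_nonneg.2 (h.trans ha)))))
  convert h1 using 1
  ext i
  simp only [Pi.smul_apply, Pi.add_apply, Pi.mul_apply, smul_eq_mul]
  have x1 : (i : ℝ) + c₁ ≠ 0 := by positivity
  have x2 : (i : ℝ) + c₂ ≠ 0 := by positivity
  field_simp
  ring

lemma d2_iterate_apply (a : ℕ → ℕ → ℝ) (k m n : ℕ) : d2^[k] a m n = dSeq^[k] (a m) n := by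
  induction k generalizing n with
  | zero => rfl
  | succ k ih => rw [Function.iterate_succ_apply', Function.iterate_succ_apply', d2, dSeq, ih, ih]

lemma d1_iterate_apply (a : ℕ → ℕ → ℝ) (k m n : ℕ) :
    d1^[k] a m n = dSeq^[k] (fun i => a i n) m := by
  induction k generalizing m with
  | zero => rfl
  | succ k ih => rw [Function.iterate_succ_apply', Function.iterate_succ_apply', d1, dSeq, ih, ih]

lemma jointCompMono_of_negDiff (a : ℕ → ℕ → ℝ)
    (h : ∀ k n : ℕ, CompMono (fun i => (negDiff ^ k) (a i) n)) : JointCompMono a := by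
  intro β₁ β₂ m n
  have h1 := (compMono_iff _).1 (h β₂ n) β₁ m
  have h2 : (fun i => (negDiff ^ β₂) (a i) n)
      = (-1 : ℝ) ^ β₂ • fun i => d2^[β₂] a i n := by
    ext i
    rw [negDiff_pow_eq, Pi.smul_apply, d2_iterate_apply, smul_eq_mul]
  rw [h2, map_smul, Pi.smul_apply, smul_eq_mul, negDiff_pow_eq] at h1
  rw [d1_iterate_apply, pow_add]
  linarith

theorem statement14 (a₀ b₀ a₁ a₂ b₁ b₂ : ℝ)
    (ha₀ : 0 < a₀) (hb₀ : 0 < b₀) (ha₁ : 0 < a₁) (ha₂ : 0 < a₂)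
    (hb₁ : 0 < b₁) (hb₂ : 0 < b₂) (ha : a₁ ≤ a₂) (hb : b₁ ≤ b₂)
    (h1 : (b₁ ≤ a₁ ∧ a₁ ≤ b₂) ∨ (b₁ ≤ a₂ ∧ a₂ ≤ b₂))
    (h2 : b₁ + b₂ ≤ a₁ + a₂) :
    MinJointCompMono (fun m n =>
      1 / (b₀ * ((m : ℝ) + b₁) * ((m : ℝ) + b₂) +
        a₀ * ((m : ℝ) + a₁) * ((m : ℝ) + a₂) * n)) := by
  obtain ⟨h₁, h₂⟩ : b₁ ≤ a₁ ∧ a₁ ≤ b₂ := by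
    rcases h1 with h | h
    · exact h
    · exact ⟨by linarith, by linarith⟩
  have hfac := fun s : ℕ => exists_factorization ha₀ hb₀ hb₁ ha h₁ h₂ h2 (Nat.cast_nonneg s)
  refine ⟨jointCompMono_of_negDiff _ fun k n => ?_, fun ε hε => ?_, fun ε hε => ?_⟩
  · obtain ⟨c₁, c₂, hc₁, -, hc₂, -, hc⟩ := hfac n
    have hbase : CompMono (fun i : ℕ => 1 / (b₀ * ((i : ℝ) + b₁) * ((i : ℝ) + b₂) +
        a₀ * ((i : ℝ) + a₁) * ((i : ℝ) + a₂) * n)) := by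
      convert ((compMono_one_div_add hc₁).mul (compMono_one_div_add hc₂)).smul
        (c := 1 / (b₀ + a₀ * n)) (by positivity) using 1
      ext i
      simp only [hc, Pi.smul_apply, Pi.mul_apply, smul_eq_mul, one_div, mul_inv]
      ring
    have hratio : ∀ s : ℕ, CompMono (fun i : ℕ => a₀ * ((i : ℝ) + a₁) * ((i : ℝ) + a₂) /
        (b₀ * ((i : ℝ) + b₁) * ((i : ℝ) + b₂) + a₀ * ((i : ℝ) + a₁) * ((i : ℝ) + a₂) * s)) := by
      intro s
      obtain ⟨c₁, c₂, hc₁, hca, hc₂, hsum, hc⟩ := hfac s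
      convert (compMono_quadratic_ratio ha hc₁ hca hc₂ hsum).smul
        (c := a₀ / (b₀ + a₀ * s)) (by positivity) using 1
      ext i
      simp only [hc, Pi.smul_apply, smul_eq_mul]
      rw [div_mul_div_comm, mul_assoc, mul_assoc]
    convert (hbase.mul (compMono_prod (Finset.range k) _
      fun j _ => hratio (n + (j + 1)))).smul (c := k.factorial) (by positivity) using 1
    ext i
    rw [negDiff_pow_one_div_affine (by positivity) (by positivity), Finset.prod_range_succ']
    simp only [Pi.smul_apply, Pi.mul_apply, Finset.prod_apply, smul_eq_mul,
      Finset.prod_div_distrib, Finset.prod_const, Finset.card_range, add_zero]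
    rw [div_mul_div_comm, one_mul, mul_div_assoc, mul_comm (∏ _ ∈ _, _)]
  · have := not_compMono_one_div_quadratic_sub hb₀ hb₁ hb hε
    simpa [Pi.sub_def] using this
  · have := not_compMono_one_div_affine_sub
      (show 0 < a₀ * (((0 : ℕ) : ℝ) + a₁) * (((0 : ℕ) : ℝ) + a₂) by positivity)
      (show 0 < b₀ * (((0 : ℕ) : ℝ) + b₁) * (((0 : ℕ) : ℝ) + b₂) by positivity) hε
    exact this
end
end

section
/- Let H be a complex Hilbert space, let m and n be positive integers, and let T = (T_1, …, T_n) be a commuting n-tuple of bounded linear operators on H. Define the operator-valued net 𝔪(α) = T^{*α} T^{α} for α ∈ ℤ₊ⁿ, where T^{α} = ∏_{j=1}^n T_j^{α_j}, and let Δ^β denote the iterated forward difference operator acting on this net (Δ_j 𝔪(α) = 𝔪(α + ε_j) − 𝔪(α)). Then T is a toral m-isometry if and only if for every α ∈ ℤ₊ⁿ, T^{*α}T^{α} = ∑_{k=0}^{m−1} ∑_{β ∈ ℤ₊ⁿ, |β| = k} ( (Δ^β 𝔪)(0) / β! ) · (α)_β, where (α)_β = ∏_{j=1}^n α_j(α_j−1)⋯(α_j−β_j+1)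 is the product of falling factorials and β! = ∏_{j=1}^n β_j!. -/
open ContinuousLinearMap

noncomputable section

variable {H : Type*} [NormedAddCommGroup H] [InnerProductSpace ℂ H] [CompleteSpace H]

/-- `T^α = ∏ⱼ Tⱼ^{αⱼ}` for a (commuting) tuple of operators. -/
def opPow {n : ℕ} (T : Fin n → (H →L[ℂ] H)) (α : Fin n → ℕ) : H →L[ℂ] H :=
  (List.ofFn (fun j => (T j) ^ (α j))).prod

/-- The operator net `𝔪(α) = T^{*α} T^{α}`. -/
def opNet {n : ℕ} (T : Fin n → (H →L[ℂ] H)) (α : Fin n → ℕ) : H →L[ℂ] H :=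
  adjoint (opPow T α) * opPow T α

/-- `T` is a toral `m`-isometry. -/
def ToralIsometry {n : ℕ} (T : Fin n → (H →L[ℂ] H)) (m : ℕ) : Prop :=
  ∀ β : Fin n → ℕ, (∑ j, β j) = m →
    ∑ α ∈ Finset.Iic β,
      (((-1 : ℂ) ^ (∑ j, α j)) * ∏ j, ((β j).choose (α j) : ℂ)) • opNet T α = 0

/-- Forward difference of an operator-valued net in the `j`-th direction. -/
def opDiff {n : ℕ} (j : Fin n) (f : (Fin n → ℕ) → (H →L[ℂ] H)) :
    (Fin n → ℕ) → (H →L[ℂ] H) :=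
  fun α => f (α + Pi.single j 1) - f α

/-- Iterated forward difference `Δ^β` of an operator-valued net. -/
def opDiffPow {n : ℕ} (β : Fin n → ℕ) (f : (Fin n → ℕ) → (H →L[ℂ] H)) :
    (Fin n → ℕ) → (H →L[ℂ] H) :=
  ((List.ofFn (fun j : Fin n => (opDiff j (H := H))^[β j])).foldr (· ∘ ·) id) f

open MvPolynomial in
/-- The linear functional on polynomials sending the monomial `X^α` to `f α`. -/
def netFunctional {n : ℕ} {V : Type*} [AddCommGroup V] [Module ℂ V] (f : (Fin n → ℕ) → V) :
    MvPolynomial (Fin n) ℂ →ₗ[ℂ] V :=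
  (basisMonomials (Fin n) ℂ).constr ℂ (fun s => f ⇑s)

section NetFunctional

open MvPolynomial

variable {n : ℕ} {V W : Type*} [AddCommGroup V] [Module ℂ V] [AddCommGroup W] [Module ℂ W]

theorem prod_X_pow_eq_basisMonomials (s : Fin n →₀ ℕ) :
    (∏ j, X j ^ s j : MvPolynomial (Fin n) ℂ) = basisMonomials (Fin n) ℂ s := by
  simp only [coe_basisMonomials]
  rw [monomial_eq, map_one, one_mul, Finsupp.prod_fintype _ _ (by simp)]

theorem netFunctional_prod_X_pow (f : (Fin n → ℕ) → V) (α : Fin n → ℕ) :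
    netFunctional f (∏ j, X j ^ α j) = f α := by
  have h := prod_X_pow_eq_basisMonomials (Finsupp.equivFunOnFinite.symm α)
  simp only [Finsupp.equivFunOnFinite_symm_apply_apply] at h
  rw [h, netFunctional, Module.Basis.constr_basis]
  rfl

theorem linearMap_ext_prod_X_pow {φ ψ : MvPolynomial (Fin n) ℂ →ₗ[ℂ] V}
    (h : ∀ α : Fin n → ℕ, φ (∏ j, X j ^ α j) = ψ (∏ j, X j ^ α j)) : φ = ψ :=
  (basisMonomials (Fin n) ℂ).ext fun s => by
    simpa only [prod_X_pow_eq_basisMonomials] using h s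

/-- If translating `f` amounts to applying a linear map, the same holds for the functional. -/
theorem netFunctional_prod_X_pow_mul {f : (Fin n → ℕ) → V} {α : Fin n → ℕ} {L : V →ₗ[ℂ] V}
    (h : ∀ γ, f (α + γ) = L (f γ)) (p : MvPolynomial (Fin n) ℂ) :
    netFunctional f ((∏ j, X j ^ α j) * p) = L (netFunctional f p) := by
  suffices netFunctional f ∘ₗ LinearMap.mulLeft ℂ (∏ j, X j ^ α j) = L ∘ₗ netFunctional f from
    LinearMap.congr_fun this p
  refine linearMap_ext_prod_X_pow fun γ => ?_
  have hmul : (∏ j, X j ^ α j) * (∏ j, X j ^ γ j) =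
      (∏ j, X j ^ (α + γ) j : MvPolynomial (Fin n) ℂ) := by
    simp [Finset.prod_mul_distrib, pow_add]
  simp only [LinearMap.comp_apply, LinearMap.mulLeft_apply, hmul, netFunctional_prod_X_pow, h]

theorem netFunctional_mul_eq_zero {f : (Fin n → ℕ) → V} {p : MvPolynomial (Fin n) ℂ}
    (h : ∀ α : Fin n → ℕ, netFunctional f ((∏ j, X j ^ α j) * p) = 0)
    (q : MvPolynomial (Fin n) ℂ) : netFunctional f (q * p) = 0 := by
  suffices netFunctional f ∘ₗ LinearMap.mulRight ℂ p = 0 from LinearMap.congr_fun this q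
  exact linearMap_ext_prod_X_pow fun γ => by simpa using h γ

theorem prod_add_one_pow {R : Type*} [CommRing R] [Algebra ℂ R] (x : Fin n → R)
    (β : Fin n → ℕ) :
    ∏ j, (x j + 1) ^ β j =
      ∑ α ∈ Finset.Iic β, (∏ j, ((β j).choose (α j) : ℂ)) • ∏ j, x j ^ α j := by
  have hI : Finset.Iic β = Fintype.piFinset fun j => Finset.range (β j + 1) := by
    ext α
    simp [Pi.le_def]
  simp only [add_pow, one_pow, mul_one, hI]
  rw [Finset.prod_univ_sum]
  refine Finset.sum_congr rfl fun α _ => ?_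
  rw [Finset.prod_mul_distrib, Algebra.smul_def, mul_comm]
  simp

/-- Newton's forward difference formula. -/
theorem newton_forward_difference (f : (Fin n → ℕ) → V) (α : Fin n → ℕ) :
    f α = ∑ β ∈ Finset.Iic α, (∏ j, ((α j).choose (β j) : ℂ)) •
      netFunctional f (∏ j, (X j - 1) ^ β j) := by
  rw [← netFunctional_prod_X_pow f α]
  simp only [← map_smul, ← map_sum]
  rw [← prod_add_one_pow]
  simp

theorem netFunctional_prod_one_sub (f : (Fin n → ℕ) → V) (β : Fin n → ℕ) :
    ∑ α ∈ Finset.Iic β,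
      (((-1 : ℂ) ^ (∑ j, α j)) * ∏ j, ((β j).choose (α j) : ℂ)) • f α =
    (-1 : ℂ) ^ (∑ j, β j) • netFunctional f (∏ j, (X j - 1) ^ β j) := by
  have hneg (x : Fin n → MvPolynomial (Fin n) ℂ) (γ : Fin n → ℕ) :
      ∏ j, (-x j) ^ γ j = (-1 : ℂ) ^ (∑ j, γ j) • ∏ j, x j ^ γ j := by
    simp only [neg_pow (x _), Finset.prod_mul_distrib, Finset.prod_pow_eq_pow_sum,
      Algebra.smul_def, map_pow, map_neg, map_one]
  rw [← map_smul, ← hneg]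
  have h := prod_add_one_pow (fun j => -(X j : MvPolynomial (Fin n) ℂ)) β
  simp only [hneg X] at h
  have hsub (j : Fin n) : -(X j - 1 : MvPolynomial (Fin n) ℂ) = -X j + 1 := by ring
  simp only [hsub, h, map_sum, map_smul, netFunctional_prod_X_pow, smul_smul]
  exact Finset.sum_congr rfl fun α _ => by rw [mul_comm]

theorem opDiff_iterate_netFunctional (f : (Fin n → ℕ) → (H →L[ℂ] H)) (j : Fin n) (k : ℕ)
    (p : MvPolynomial (Fin n) ℂ) :
    (opDiff j)^[k] (fun α => netFunctional f ((∏ i, X i ^ α i) * p)) =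
      fun α => netFunctional f ((∏ i, X i ^ α i) * ((X j - 1) ^ k * p)) := by
  induction k with
  | zero => simp
  | succ k ih =>
    rw [Function.iterate_succ_apply', ih]
    funext α
    have hX : (∏ i, X i ^ (α + Pi.single j 1 : Fin n → ℕ) i : MvPolynomial (Fin n) ℂ) =
        (∏ i, X i ^ α i) * X j := by
      have hj : ∏ i, X i ^ (Pi.single j 1 : Fin n → ℕ) i = (X j : MvPolynomial (Fin n) ℂ) := by
        rw [Finset.prod_eq_single j (fun i _ hij => by simp [hij]) (by simp)]
        simp
      simp only [Pi.add_apply, pow_add, Finset.prod_mul_distrib, hj]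
    simp only [opDiff, hX, ← map_sub]
    congr 1
    ring

theorem opDiffPow_eq_netFunctional (f : (Fin n → ℕ) → (H →L[ℂ] H)) (β : Fin n → ℕ) :
    opDiffPow β f 0 = netFunctional f (∏ j, (X j - 1) ^ β j) := by
  have key (l : List (Fin n)) :
      ((l.map fun j => (opDiff j (H := H))^[β j]).foldr (· ∘ ·) id) f =
        fun α => netFunctional f
          ((∏ i, X i ^ α i) * (l.map fun j => (X j - 1) ^ β j).prod) := by
    induction l with
    | nil => funext α; simp [netFunctional_prod_X_pow]
    | cons j l ih =>
      simp only [List.map_cons, List.foldr_cons, Function.comp_apply, List.prod_cons]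
      rw [ih, opDiff_iterate_netFunctional]
  rw [opDiffPow, List.ofFn_eq_map, key, ← List.ofFn_eq_map, List.prod_ofFn]
  simp

end NetFunctional

theorem opPow_add {n : ℕ} {T : Fin n → (H →L[ℂ] H)} (hcomm : ∀ i j, T i * T j = T j * T i)
    (α β : Fin n → ℕ) : opPow T (α + β) = opPow T α * opPow T β := by
  have key (l : List (Fin n)) : (l.map fun j => T j ^ (α + β) j).prod =
      (l.map fun j => T j ^ α j).prod * (l.map fun j => T j ^ β j).prod := by
    induction l with
    | nil => simp
    | cons j l ih =>
      have hc : Commute (T j ^ β j) (l.map fun j => T j ^ α j).prod := by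
        refine Commute.list_prod_right _ _ fun x hx => ?_
        obtain ⟨i, -, rfl⟩ := List.mem_map.1 hx
        exact Commute.pow_pow (hcomm j i) _ _
      simp only [List.map_cons, List.prod_cons]
      rw [ih, Pi.add_apply, pow_add, mul_assoc, ← mul_assoc (T j ^ β j), hc.eq]
      simp only [mul_assoc]
  simpa only [opPow, List.ofFn_eq_map] using key _

theorem opNet_add {n : ℕ} {T : Fin n → (H →L[ℂ] H)} (hcomm : ∀ i j, T i * T j = T j * T i)
    (α γ : Fin n → ℕ) :
    opNet T (α + γ) = adjoint (opPow T α) * opNet T γ * opPow T α := by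
  rw [opNet, opNet, add_comm, opPow_add hcomm, ← star_eq_adjoint, ← star_eq_adjoint,
    ← star_eq_adjoint, star_mul]
  simp only [mul_assoc]

theorem toralIsometry_iff {n : ℕ} (T : Fin n → (H →L[ℂ] H)) (m : ℕ) :
    ToralIsometry T m ↔ ∀ β : Fin n → ℕ, (∑ j, β j) = m → opDiffPow β (opNet T) 0 = 0 := by
  refine forall_congr' fun β => imp_congr_right fun _ => ?_
  rw [netFunctional_prod_one_sub, opDiffPow_eq_netFunctional]
  simp

theorem exists_le_sum_eq {ι : Type*} [Fintype ι] [DecidableEq ι] (β : ι → ℕ) (m : ℕ)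
    (h : m ≤ ∑ j, β j) : ∃ γ ≤ β, ∑ j, γ j = m := by
  induction m with
  | zero => exact ⟨0, fun j => Nat.zero_le _, by simp⟩
  | succ m ih =>
    obtain ⟨γ, hγ, hsum⟩ := ih (by omega)
    obtain ⟨j, -, hj⟩ := Finset.exists_lt_of_sum_lt (s := Finset.univ) (f := γ) (g := β) (by omega)
    refine ⟨γ + Pi.single j 1, fun i => ?_, by simp [Finset.sum_add_distrib, hsum]⟩
    obtain rfl | hij := eq_or_ne i j
    · simpa using hj
    · simpa [hij] using hγ i

theorem ToralIsometry.opDiffPow_eq_zero {n m : ℕ} {T : Fin n → (H →L[ℂ] H)}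
    (hcomm : ∀ i j, T i * T j = T j * T i) (hT : ToralIsometry T m) {β : Fin n → ℕ}
    (hβ : m ≤ ∑ j, β j) : opDiffPow β (opNet T) 0 = 0 := by
  obtain ⟨γ, hγ, hsum⟩ := exists_le_sum_eq β m hβ
  have h0 := (toralIsometry_iff T m).1 hT γ hsum
  rw [opDiffPow_eq_netFunctional] at h0 ⊢
  have hsplit : ∏ j, (MvPolynomial.X j - 1 : MvPolynomial (Fin n) ℂ) ^ β j =
      (∏ j, (MvPolynomial.X j - 1) ^ (β j - γ j)) * ∏ j, (MvPolynomial.X j - 1) ^ γ j := by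
    rw [← Finset.prod_mul_distrib]
    exact Finset.prod_congr rfl fun j _ => by rw [← pow_add, Nat.sub_add_cancel (hγ j)]
  rw [hsplit]
  refine netFunctional_mul_eq_zero (fun α => ?_) _
  rw [netFunctional_prod_X_pow_mul
    (L := LinearMap.mulRight ℂ (opPow T α) ∘ₗ LinearMap.mulLeft ℂ (adjoint (opPow T α)))
    (fun γ => by simpa using opNet_add hcomm α γ), h0, map_zero]

theorem prod_descFactorial_div_prod_factorial {n : ℕ} (α β : Fin n → ℕ) :
    (∏ j, ((α j).descFactorial (β j) : ℂ)) / ∏ j, ((β j).factorial : ℂ) =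
      ∏ j, ((α j).choose (β j) : ℂ) := by
  rw [← Finset.prod_div_distrib]
  refine Finset.prod_congr rfl fun j _ => ?_
  rw [Nat.descFactorial_eq_factorial_mul_choose, Nat.cast_mul,
    mul_div_cancel_left₀ _ (Nat.cast_ne_zero.2 (Nat.factorial_ne_zero _))]

theorem sum_descFactorial_smul {n : ℕ} {V : Type*} [AddCommGroup V] [Module ℂ V] (m : ℕ)
    (D : (Fin n → ℕ) → V) (α : Fin n → ℕ) :
    (∑ k ∈ Finset.range m,
      ∑ β ∈ (Finset.Iic (fun _ => k : Fin n → ℕ)).filter (fun β => (∑ j, β j) = k),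
        ((∏ j, ((α j).descFactorial (β j) : ℂ)) / ∏ j, ((β j).factorial : ℂ)) • D β) =
    ∑ β ∈ (Finset.Iic α).filter (fun β => (∑ j, β j) < m),
      (∏ j, ((α j).choose (β j) : ℂ)) • D β := by
  simp only [prod_descFactorial_div_prod_factorial]
  have hfib := Finset.sum_fiberwise_eq_sum_filter (Finset.Iic α) (Finset.range m)
    (fun β => ∑ j, β j) (fun β => (∏ j, ((α j).choose (β j) : ℂ)) • D β)
  simp only [Finset.mem_range] at hfib
  rw [← hfib]
  refine Finset.sum_congr rfl fun k _ => (Finset.sum_subset (fun β hβ => ?_)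
    fun β hβ hβα => ?_).symm
  · simp only [Finset.mem_filter, Finset.mem_Iic] at hβ ⊢
    exact ⟨fun j => hβ.2 ▸ Finset.single_le_sum (fun _ _ => Nat.zero_le _) (Finset.mem_univ j),
      hβ.2⟩
  · simp only [Finset.mem_filter, Finset.mem_Iic, Pi.le_def] at hβ hβα
    obtain ⟨j, hj⟩ : ∃ j, α j < β j := by
      by_contra! hle
      exact hβα ⟨hle, hβ.2⟩
    rw [Finset.prod_eq_zero (Finset.mem_univ j) (by simp [Nat.choose_eq_zero_of_lt hj]), zero_smul]

theorem statement17 (n m : ℕ) (hn : 0 < n) (hm : 0 < m)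
    (T : Fin n → (H →L[ℂ] H)) (hcomm : ∀ i j, T i * T j = T j * T i) :
    ToralIsometry T m ↔
      ∀ α : Fin n → ℕ, opNet T α =
        ∑ k ∈ Finset.range m,
          ∑ β ∈ (Finset.Iic (fun _ => k : Fin n → ℕ)).filter (fun β => (∑ j, β j) = k),
            ((∏ j, ((α j).descFactorial (β j) : ℂ)) / ∏ j, ((β j).factorial : ℂ)) •
              opDiffPow β (opNet T) 0 := by
  simp only [sum_descFactorial_smul]
  have newton (α : Fin n → ℕ) : opNet T α = ∑ β ∈ Finset.Iic α,
      (∏ j, ((α j).choose (β j) : ℂ)) • opDiffPow β (opNet T) 0 := by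
    simpa only [opDiffPow_eq_netFunctional] using newton_forward_difference (opNet T) α
  constructor
  · intro hT α
    rw [Finset.sum_filter_of_ne, ← newton]
    intro β _ hβ
    by_contra! hle
    exact hβ (by rw [hT.opDiffPow_eq_zero hcomm hle, smul_zero])
  · intro h
    refine (toralIsometry_iff T m).2 fun β hβ => ?_
    have hfilter : (Finset.Iic β).filter (fun γ => (∑ j, γ j) < m) = (Finset.Iic β).erase β := by
      ext γ
      simp only [Finset.mem_filter, Finset.mem_erase, Finset.mem_Iic, and_comm (a := γ ≤ β)]
      refine and_congr_left fun hle => ⟨fun hlt heq => ?_, fun hne => ?_⟩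
      · exact hlt.ne (heq ▸ hβ)
      · obtain ⟨j, hj⟩ := (Pi.lt_def.1 (lt_of_le_of_ne hle hne)).2
        exact hβ ▸ Finset.sum_lt_sum (fun i _ => hle i) ⟨j, Finset.mem_univ j, hj⟩
    have hsum := (newton β).symm.trans (h β)
    rw [hfilter, ← Finset.sum_erase_add _ _ (Finset.mem_Iic.2 le_rfl)] at hsum
    simpa using hsum
end
end

section
/- Let H be a complex Hilbert space, let m ≥ 2 be an integer, and let T = (T_1, T_2) be a commuting pair of bounded linear operators on H that is a toral m-isometry. Set A = T_1^*T_1 − I, B = T_2^*T_2 − I, and C = T_1^* B T_1 − B. Then T_1 and T_2 are both 2-isometries if and only if for every α = (α_1, α_2) ∈ ℤ₊², T^{*α}T^{α} = I + α_1·A + α_2·(B + α_1·C). Moreover, if this identity holds for all α ∈ ℤ₊², then T is a toral 3-isometry. -/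
open ContinuousLinearMap

noncomputable section

variable {H : Type*} [NormedAddCommGroup H] [InnerProductSpace ℂ H] [CompleteSpace H]

/-- `T^α = T₁^{α₁} T₂^{α₂}` for a pair of operators. -/
def opPow2 (T₁ T₂ : H →L[ℂ] H) (α : ℕ × ℕ) : H →L[ℂ] H :=
  T₁ ^ α.1 * T₂ ^ α.2

/-- The operator net `𝔪(α) = T^{*α} T^{α}` for a pair. -/
def opNet2 (T₁ T₂ : H →L[ℂ] H) (α : ℕ × ℕ) : H →L[ℂ] H :=
  adjoint (opPow2 T₁ T₂ α) * opPow2 T₁ T₂ α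

/-- A commuting pair is a toral `m`-isometry. -/
def ToralIsometry2 (T₁ T₂ : H →L[ℂ] H) (m : ℕ) : Prop :=
  ∀ β₁ β₂ : ℕ, β₁ + β₂ = m →
    ∑ α₁ ∈ Finset.range (β₁ + 1), ∑ α₂ ∈ Finset.range (β₂ + 1),
      (((-1 : ℂ) ^ (α₁ + α₂)) * (β₁.choose α₁ : ℂ) * (β₂.choose α₂ : ℂ)) •
        opNet2 T₁ T₂ (α₁, α₂) = 0

/-- A single operator is a 2-isometry: `S^{*2}S² − 2S^*S + I = 0`. -/
def TwoIsometry (S : H →L[ℂ] H) : Prop :=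
  adjoint (S ^ 2) * S ^ 2 - (2 : ℂ) • (adjoint S * S) + 1 = 0

theorem TwoIsometry.adjoint_pow_mul_pow {S : H →L[ℂ] H} (hS : TwoIsometry S) (n : ℕ) :
    adjoint (S ^ n) * S ^ n = 1 + (n : ℂ) • (adjoint S * S - 1) := by
  simp only [TwoIsometry, ← star_eq_adjoint] at hS ⊢
  have hsq : star S * (star S * S) * S = (2 : ℂ) • (star S * S) - 1 := by
    rw [← sub_eq_zero, ← hS, pow_two, star_mul]
    simp only [mul_assoc]
    abel
  induction n with
  | zero => simp
  | succ n ih =>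
    calc star (S ^ (n + 1)) * S ^ (n + 1) = star S * (star (S ^ n) * S ^ n) * S := by
          simp only [pow_succ, star_mul, mul_assoc]
      _ = star S * S + (n : ℂ) • (star S * (star S * S) * S - star S * S) := by
          rw [ih]
          simp only [mul_add, add_mul, mul_sub, sub_mul, mul_one, mul_smul_comm, smul_mul_assoc]
      _ = 1 + ((n + 1 : ℕ) : ℂ) • (star S * S - 1) := by
          rw [hsq]
          push_cast
          module

theorem TwoIsometry.opNet2_eq {T₁ T₂ : H →L[ℂ] H} (h₁ : TwoIsometry T₁) (h₂ : TwoIsometry T₂)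
    (hcomm : Commute T₁ T₂) (α : ℕ × ℕ) :
    opNet2 T₁ T₂ α = 1 + (α.1 : ℂ) • (adjoint T₁ * T₁ - 1) +
      (α.2 : ℂ) • ((adjoint T₂ * T₂ - 1) +
        (α.1 : ℂ) • (adjoint T₁ * (adjoint T₂ * T₂ - 1) * T₁ - (adjoint T₂ * T₂ - 1))) := by
  obtain ⟨a, b⟩ := α
  have hp₁ := h₁.adjoint_pow_mul_pow a
  have hp₂ := h₂.adjoint_pow_mul_pow b
  simp only [opNet2, opPow2, ← star_eq_adjoint] at hp₁ hp₂ ⊢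
  have hswap : T₁ * T₂ ^ b = T₂ ^ b * T₁ := hcomm.pow_right b
  have hconj : star (T₂ ^ b) * (star T₁ * T₁) * T₂ ^ b =
      star T₁ * (star (T₂ ^ b) * T₂ ^ b) * T₁ := by
    calc star (T₂ ^ b) * (star T₁ * T₁) * T₂ ^ b
        = star (T₁ * T₂ ^ b) * (T₁ * T₂ ^ b) := by simp only [star_mul, mul_assoc]
      _ = star T₁ * (star (T₂ ^ b) * T₂ ^ b) * T₁ := by
          rw [hswap]
          simp only [star_mul, mul_assoc]
  calc star (T₁ ^ a * T₂ ^ b) * (T₁ ^ a * T₂ ^ b)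
      = star (T₂ ^ b) * (star (T₁ ^ a) * T₁ ^ a) * T₂ ^ b := by
        simp only [star_mul, mul_assoc]
    _ = star (T₂ ^ b) * T₂ ^ b +
          (a : ℂ) • (star (T₂ ^ b) * (star T₁ * T₁) * T₂ ^ b - star (T₂ ^ b) * T₂ ^ b) := by
        rw [hp₁]
        simp only [mul_add, add_mul, mul_sub, sub_mul, mul_one, mul_smul_comm, smul_mul_assoc]
    _ = _ := by
        rw [hconj, hp₂]
        simp only [mul_add, add_mul, mul_sub, sub_mul, mul_one, mul_smul_comm, smul_mul_assoc]
        module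

theorem toralIsometry2_three_of_opNet2_eq {T₁ T₂ A B C : H →L[ℂ] H}
    (h : ∀ α : ℕ × ℕ, opNet2 T₁ T₂ α = 1 + (α.1 : ℂ) • A + (α.2 : ℂ) • (B + (α.1 : ℂ) • C)) :
    ToralIsometry2 T₁ T₂ 3 := by
  intro β₁ β₂ hβ
  obtain ⟨rfl, rfl⟩ | ⟨rfl, rfl⟩ | ⟨rfl, rfl⟩ | ⟨rfl, rfl⟩ :
      (β₁ = 0 ∧ β₂ = 3) ∨ (β₁ = 1 ∧ β₂ = 2) ∨ (β₁ = 2 ∧ β₂ = 1) ∨ (β₁ = 3 ∧ β₂ = 0) := by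
    omega
  all_goals
    simp only [h, Finset.sum_range_succ, Finset.sum_range_zero, Nat.choose]
    push_cast
    module

theorem statement19 (m : ℕ) (hm : 2 ≤ m) (T₁ T₂ : H →L[ℂ] H)
    (hcomm : T₁ * T₂ = T₂ * T₁) (hT : ToralIsometry2 T₁ T₂ m) :
    ((TwoIsometry T₁ ∧ TwoIsometry T₂) ↔
      ∀ α : ℕ × ℕ, opNet2 T₁ T₂ α =
        1 + (α.1 : ℂ) • (adjoint T₁ * T₁ - 1) +
          (α.2 : ℂ) • ((adjoint T₂ * T₂ - 1) +
            (α.1 : ℂ) • (adjoint T₁ * (adjoint T₂ * T₂ - 1) * T₁ - (adjoint T₂ * T₂ - 1)))) ∧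
    ((∀ α : ℕ × ℕ, opNet2 T₁ T₂ α =
        1 + (α.1 : ℂ) • (adjoint T₁ * T₁ - 1) +
          (α.2 : ℂ) • ((adjoint T₂ * T₂ - 1) +
            (α.1 : ℂ) • (adjoint T₁ * (adjoint T₂ * T₂ - 1) * T₁ - (adjoint T₂ * T₂ - 1)))) →
      ToralIsometry2 T₁ T₂ 3) := by
  refine ⟨⟨fun ⟨h₁, h₂⟩ => h₁.opNet2_eq h₂ hcomm, fun h => ⟨?_, ?_⟩⟩,
    toralIsometry2_three_of_opNet2_eq⟩
  · have h20 := h (2, 0)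
    simp only [opNet2, opPow2, pow_zero, mul_one] at h20
    rw [TwoIsometry, h20]
    push_cast
    module
  · have h02 := h (0, 2)
    simp only [opNet2, opPow2, pow_zero, one_mul] at h02
    rw [TwoIsometry, h02]
    push_cast
    module
end
end
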